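/- Let E = (1/N!) Σ_{σ∈S_N} σ̂ ∈ H (the symmetrizer; E² = E), and let EHE = {E∘a∘E : a ∈ H}, which is a subalgebra of End_C(C[z,λ]) with unit element E. Then the Satake map from the center Z(H) of H to EHE given by c ↦ c∘E is a ring isomorphism onto EHE, and EHE is generated as a C-algebra (with unit E) by the elements c_ij∘E, 0 ≤ i,j ≤ N. -/

import Mathlib

open MvPolynomial

noncomputable section

abbrev Rzl (N : ℕ) := MvPolynomial (Fin N ⊕ Fin N) ℂ

def permHat (N : ℕ) (σ : Equiv.Perm (Fin N)) : Rzl N ≃ₐ[ℂ] Rzl N :=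
  renameEquiv ℂ (Equiv.sumCongr σ σ)

/-- The automorphism `σ̂` as an endomorphism of `ℂ[z,λ]`. -/
def permOp (N : ℕ) (σ : Equiv.Perm (Fin N)) : Module.End ℂ (Rzl N) :=
  (permHat N σ).toLinearMap

/-- The automorphism `s_ij^z` exchanging `z_i ↔ z_j` only. -/
def sZ (N : ℕ) (i j : Fin N) : Rzl N ≃ₐ[ℂ] Rzl N :=
  renameEquiv ℂ (Equiv.sumCongr (Equiv.swap i j) (Equiv.refl (Fin N)))

/-- The automorphism `s_ij^λ` exchanging `λ_i ↔ λ_j` only. -/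
def sL (N : ℕ) (i j : Fin N) : Rzl N ≃ₐ[ℂ] Rzl N :=
  renameEquiv ℂ (Equiv.sumCongr (Equiv.refl (Fin N)) (Equiv.swap i j))

/-- Multiplication by a polynomial, as an endomorphism of `ℂ[z,λ]`. -/
def mulP (N : ℕ) (p : Rzl N) : Module.End ℂ (Rzl N) := LinearMap.mulLeft ℂ p

/-- Product of the endomorphisms `f i`, `i ∈ T`, taken in increasing order of `i`
(the order is irrelevant when the factors pairwise commute). -/
def ordProd {N : ℕ} (T : Finset (Fin N)) (f : Fin N → Module.End ℂ (Rzl N)) :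
    Module.End ℂ (Rzl N) :=
  ((T.sort (· ≤ ·)).map f).prod

/-- The universal central polynomial evaluated at `(u,v)`:
`P(u,v) = (−1)^N Σ_σ sgn(σ) (Σ_{T ⊆ Fix σ} (−1)^{|T|} (Π_{i∈T}(v−λ_i))·(Π_{i∈T}(u−K_i))) ∘ σ̂`. -/
def Puv {N : ℕ} (K : Fin N → Module.End ℂ (Rzl N)) (u v : ℂ) : Module.End ℂ (Rzl N) :=
  ((-1 : ℤ) ^ N) • ∑ σ : Equiv.Perm (Fin N), (Equiv.Perm.sign σ : ℤ) •
    ((∑ T ∈ (Finset.univ.filter fun i => σ i = i).powerset,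
        ((-1 : ℤ) ^ T.card) •
          (mulP N (∏ i ∈ T, ((C v : Rzl N) - X (Sum.inr i))) *
            ordProd T (fun i => u • (1 : Module.End ℂ (Rzl N)) - K i))) * permOp N σ)

set_option synthInstance.maxHeartbeats 1000000 in

/-- The realization `H` of the rational Cherednik algebra: the unital subalgebra of
`End_ℂ(ℂ[z,λ])` generated by the multiplications by `λ_1,…,λ_N`, the operators
`K_1,…,K_N` and the automorphisms `σ̂`. -/
def cherednik (N : ℕ) (K : Fin N → Module.End ℂ (Rzl N)) :
    Subalgebra ℂ (Module.End ℂ (Rzl N)) :=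
  Algebra.adjoin ℂ
    ((Set.range fun i => mulP N (X (Sum.inr i))) ∪ Set.range K ∪ Set.range (permOp N))

/-- The center of `H`, as a subalgebra of `End_ℂ(ℂ[z,λ])`. -/
def cherednikCenter (N : ℕ) (K : Fin N → Module.End ℂ (Rzl N)) :
    Subalgebra ℂ (Module.End ℂ (Rzl N)) :=
  cherednik N K ⊓ Subalgebra.centralizer ℂ (cherednik N K : Set (Module.End ℂ (Rzl N)))

/-- The symmetrizer `E = (1/N!) Σ_σ σ̂`. -/
def symE (N : ℕ) : Module.End ℂ (Rzl N) :=
  ((Nat.factorial N : ℂ)⁻¹) • ∑ σ : Equiv.Perm (Fin N), permOp N σ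

section CommEval

variable {ι A : Type*} [Ring A] [Algebra ℂ A]

open scoped IsMulCommutative in
/-- Evaluation of polynomials at a family of pairwise commuting elements of an algebra. -/
def commEval (x : ι → A) (h : ∀ i j, Commute (x i) (x j)) : MvPolynomial ι ℂ →ₐ[ℂ] A :=
  haveI := Algebra.isMulCommutative_adjoin ℂ (s := Set.range x)
    (by rintro _ ⟨i, rfl⟩ _ ⟨j, rfl⟩; exact h i j)
  (Algebra.adjoin ℂ (Set.range x)).val.comp
    (aeval fun i => (⟨x i, Algebra.subset_adjoin ⟨i, rfl⟩⟩ : Algebra.adjoin ℂ (Set.range x)))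

@[simp]
lemma commEval_X (x : ι → A) (h : ∀ i j, Commute (x i) (x j)) (i : ι) :
    commEval x h (X i) = x i := by
  simp [commEval]

@[simp]
lemma commEval_C (x : ι → A) (h : ∀ i j, Commute (x i) (x j)) (u : ℂ) :
    commEval x h (C u) = algebraMap ℂ A u :=
  (commEval x h).commutes u

lemma commEval_commute (x : ι → A) (h : ∀ i j, Commute (x i) (x j)) (p q : MvPolynomial ι ℂ) :
    Commute (commEval x h p) (commEval x h q) := by
  rw [commute_iff_eq, ← map_mul, ← map_mul, mul_comm]

lemma mul_commEval (x : ι → A) (h : ∀ i j, Commute (x i) (x j)) (g : A) (f : ι → ι)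
    (hg : ∀ i, g * x i = x (f i) * g) (p : MvPolynomial ι ℂ) :
    g * commEval x h p = commEval x h (rename f p) * g := by
  induction p using MvPolynomial.induction_on with
  | C a => simp [Algebra.commutes]
  | add p q hp hq => simp [mul_add, add_mul, hp, hq]
  | mul_X p i hp =>
    rw [map_mul, map_mul, map_mul, rename_X, commEval_X, commEval_X, ← mul_assoc, hp, mul_assoc,
      hg, mul_assoc]

lemma commEval_mem_adjoin (x : ι → A) (h : ∀ i j, Commute (x i) (x j)) (p : MvPolynomial ι ℂ)
    (S : Subalgebra ℂ A) (hS : ∀ i, x i ∈ S) : commEval x h p ∈ S := by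
  induction p using MvPolynomial.induction_on with
  | C a => rw [commEval_C]; exact S.algebraMap_mem a
  | add p q hp hq => rw [map_add]; exact S.add_mem hp hq
  | mul_X p i hp => rw [map_mul, commEval_X]; exact S.mul_mem hp (hS i)

end CommEval

/-- Elements of an algebra satisfying the defining relations of the rational Cherednik algebra
of type `A` at `t = 0`. -/
structure CherednikData (N : ℕ) (A : Type*) [Ring A] [Algebra ℂ A] where
  lam : Fin N → A
  K : Fin N → A
  s : Equiv.Perm (Fin N) →* A
  lam_comm : ∀ i j, Commute (lam i) (lam j)
  K_comm : ∀ i j, Commute (K i) (K j)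
  s_lam : ∀ σ i, s σ * lam i = lam (σ i) * s σ
  s_K : ∀ σ i, s σ * K i = K (σ i) * s σ
  K_lam_of_ne : ∀ i j, i ≠ j → K i * lam j = lam j * K i - s (Equiv.swap i j)
  K_lam_self : ∀ i, K i * lam i = lam i * K i + ∑ j ∈ Finset.univ.erase i, s (Equiv.swap i j)

namespace CherednikData

variable {N : ℕ} {A : Type*} [Ring A] [Algebra ℂ A] (H : CherednikData N A)

/-- Evaluation of a polynomial at the `lam i`. -/
def evLam : MvPolynomial (Fin N) ℂ →ₐ[ℂ] A := commEval H.lam H.lam_comm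

/-- Evaluation of a polynomial at the `K i`. -/
def evK : MvPolynomial (Fin N) ℂ →ₐ[ℂ] A := commEval H.K H.K_comm

lemma s_evLam (σ : Equiv.Perm (Fin N)) (p : MvPolynomial (Fin N) ℂ) :
    H.s σ * H.evLam p = H.evLam (rename σ p) * H.s σ :=
  mul_commEval _ _ _ _ (H.s_lam σ) p

lemma s_evK (σ : Equiv.Perm (Fin N)) (p : MvPolynomial (Fin N) ℂ) :
    H.s σ * H.evK p = H.evK (rename σ p) * H.s σ :=
  mul_commEval _ _ _ _ (H.s_K σ) p

/-- The relations are preserved by the anti-involution exchanging `lam` and `K`. -/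
def op : CherednikData N Aᵐᵒᵖ where
  lam i := MulOpposite.op (H.K i)
  K i := MulOpposite.op (H.lam i)
  s :=
    { toFun := fun σ => MulOpposite.op (H.s σ⁻¹)
      map_one' := by simp
      map_mul' := fun σ τ => by simp }
  lam_comm i j := (H.K_comm i j).op
  K_comm i j := (H.lam_comm i j).op
  s_lam σ i := by
    have h := H.s_K σ⁻¹ (σ i)
    rw [← Equiv.Perm.mul_apply, inv_mul_cancel, Equiv.Perm.one_apply] at h
    simp [← MulOpposite.op_mul, h]
  s_K σ i := by
    have h := H.s_lam σ⁻¹ (σ i)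
    rw [← Equiv.Perm.mul_apply, inv_mul_cancel, Equiv.Perm.one_apply] at h
    simp [← MulOpposite.op_mul, h]
  K_lam_of_ne i j hij := by
    simp [← MulOpposite.op_mul, H.K_lam_of_ne j i hij.symm, Equiv.swap_comm i j]
  K_lam_self i := by
    simp [← MulOpposite.op_mul, H.K_lam_self i]

/-- The polynomial `∏_{i ∈ T} (u - X_i)`. -/
def rootProd {N : ℕ} (u : ℂ) (T : Finset (Fin N)) : MvPolynomial (Fin N) ℂ := ∏ i ∈ T, (C u - X i)

lemma rootProd_insert (u : ℂ) {T : Finset (Fin N)} {i : Fin N} (hi : i ∉ T) :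
    rootProd u (insert i T) = (C u - X i) * rootProd u T :=
  Finset.prod_insert hi

lemma rename_rootProd (u : ℂ) (T : Finset (Fin N)) (σ : Equiv.Perm (Fin N))
    (h : ∀ i ∈ T, σ i = i) : rename σ (rootProd u T) = rootProd u T := by
  rw [rootProd, map_prod]
  exact Finset.prod_congr rfl fun i hi => by simp [h i hi]

lemma evK_mul_evLam_of_ne (u v : ℂ) {i k : Fin N} (h : i ≠ k) :
    H.evK (C u - X i) * H.evLam (C v - X k) =
      H.evLam (C v - X k) * H.evK (C u - X i) - H.s (Equiv.swap i k) := by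
  have := H.K_lam_of_ne i k h
  simp only [evK, evLam, map_sub, commEval_C, commEval_X, mul_sub, sub_mul, this,
    Algebra.commutes u (H.lam k), (Algebra.commutes v (H.K i)).symm, Algebra.commutes v (algebraMap ℂ A u)]
  abel

lemma evK_mul_evLam_self (u v : ℂ) (k : Fin N) :
    H.evK (C u - X k) * H.evLam (C v - X k) =
      H.evLam (C v - X k) * H.evK (C u - X k) +
        ∑ j ∈ Finset.univ.erase k, H.s (Equiv.swap k j) := by
  have := H.K_lam_self k
  simp only [evK, evLam, map_sub, commEval_C, commEval_X, mul_sub, sub_mul, this,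
    Algebra.commutes u (H.lam k), (Algebra.commutes v (H.K k)).symm, Algebra.commutes v (algebraMap ℂ A u)]
  abel

lemma evK_rootProd_mul_evLam (u v : ℂ) {k : Fin N} (T : Finset (Fin N)) (hk : k ∉ T) :
    H.evK (rootProd u T) * H.evLam (C v - X k) =
      H.evLam (C v - X k) * H.evK (rootProd u T) -
        ∑ i ∈ T, H.evK (rootProd u (T.erase i)) * H.s (Equiv.swap i k) := by
  induction T using Finset.induction_on with
  | empty => simp [rootProd]
  | insert i T hi ih =>
    simp only [Finset.mem_insert, not_or] at hk
    have hs : H.s (Equiv.swap i k) * H.evK (rootProd u T) =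
        H.evK (rootProd u T) * H.s (Equiv.swap i k) := by
      rw [s_evK, rename_rootProd]
      intro j hj
      exact Equiv.swap_apply_of_ne_of_ne (by rintro rfl; exact hi hj) (by rintro rfl; exact hk.2 hj)
    have hsum : ∑ j ∈ T, H.evK (rootProd u ((insert i T).erase j)) * H.s (Equiv.swap j k) =
        H.evK (C u - X i) * ∑ j ∈ T, H.evK (rootProd u (T.erase j)) * H.s (Equiv.swap j k) := by
      rw [Finset.mul_sum]
      refine Finset.sum_congr rfl fun j hj => ?_
      have hij : i ≠ j := by rintro rfl; exact hi hj
      rw [Finset.erase_insert_of_ne hij, rootProd_insert _ (by simp [hi]), map_mul, mul_assoc]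
    rw [Finset.sum_insert hi, Finset.erase_insert hi, hsum, rootProd_insert u hi, map_mul,
      mul_assoc, ih hk.2, mul_sub, ← mul_assoc, evK_mul_evLam_of_ne _ _ _ (Ne.symm hk.1), sub_mul, hs]
    noncomm_ring

lemma evK_rootProd_insert_mul_evLam (u v : ℂ) {k : Fin N} (T : Finset (Fin N)) (hk : k ∉ T) :
    H.evK (rootProd u (insert k T)) * H.evLam (C v - X k) =
      H.evLam (C v - X k) * H.evK (rootProd u (insert k T)) +
        H.evK (rootProd u T) * ∑ j ∈ Finset.univ.erase k \ T, H.s (Equiv.swap j k) := by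
  have hsum : (∑ i ∈ T, H.evK (rootProd u (T.erase i)) * H.s (Equiv.swap i k)) *
      H.evK (C u - X k) = H.evK (rootProd u T) * ∑ i ∈ T, H.s (Equiv.swap i k) := by
    rw [Finset.sum_mul, Finset.mul_sum]
    refine Finset.sum_congr rfl fun i hi => ?_
    conv_rhs => rw [← Finset.insert_erase hi]
    rw [mul_assoc, s_evK, rootProd_insert _ (Finset.notMem_erase i T), mul_comm (C u - X i), map_mul,
      mul_assoc]
    simp
  have hT : T ⊆ Finset.univ.erase k := fun i hi => by
    simp only [Finset.mem_erase, Finset.mem_univ, and_true]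
    rintro rfl; exact hk hi
  have hsplit := Finset.sum_sdiff (f := fun j => H.s (Equiv.swap j k)) hT
  have hsw : ∑ j ∈ Finset.univ.erase k, H.s (Equiv.swap k j) =
      ∑ j ∈ Finset.univ.erase k, H.s (Equiv.swap j k) :=
    Finset.sum_congr rfl fun j _ => by rw [Equiv.swap_comm]
  rw [rootProd_insert u hk, mul_comm (C u - X k), map_mul, mul_assoc, evK_mul_evLam_self, hsw,
    mul_add, ← mul_assoc, evK_rootProd_mul_evLam _ _ _ _ hk, sub_mul, hsum, ← hsplit]
  noncomm_ring

/-- The antisymmetrizing sum over the permutations supported in `S`. -/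
def alt (S : Finset (Fin N)) : A :=
  ∑ σ ∈ Finset.univ.filter (fun σ : Equiv.Perm (Fin N) => ∀ i, i ∉ S → σ i = i),
    (Equiv.Perm.sign σ : ℤ) • H.s σ

lemma alt_empty : H.alt ∅ = 1 := by
  have : (Finset.univ.filter fun σ : Equiv.Perm (Fin N) => ∀ i, i ∉ (∅ : Finset (Fin N)) → σ i = i) =
      {1} := by
    ext σ
    simp [Equiv.ext_iff]
  rw [alt, this]
  simp

lemma alt_insert {k : Fin N} {S : Finset (Fin N)} (hk : k ∉ S) :
    H.alt (insert k S) = (1 - ∑ j ∈ S, H.s (Equiv.swap j k)) * H.alt S := by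
  have key : H.alt (insert k S) =
      ∑ j ∈ insert k S, (Equiv.Perm.sign (Equiv.swap j k) : ℤ) • (H.s (Equiv.swap j k) * H.alt S) := by
    simp only [alt, Finset.mul_sum, Finset.smul_sum]
    rw [Finset.sum_sigma']
    refine Finset.sum_bij' (fun σ _ => ⟨σ k, Equiv.swap (σ k) k * σ⟩)
      (fun x _ => Equiv.swap x.1 k * x.2) ?_ ?_ ?_ ?_ ?_
    · intro σ hσ
      simp only [Finset.mem_filter, Finset.mem_univ, true_and, Finset.mem_insert, not_or,
        Finset.mem_sigma, Equiv.Perm.mul_apply] at hσ ⊢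
      refine ⟨?_, fun i hi => ?_⟩
      · by_contra h
        push Not at h
        exact h.1 (σ.injective (hσ _ h))
      · by_cases hik : i = k
        · subst hik; simp
        · rw [hσ i ⟨hik, hi⟩]
          refine Equiv.swap_apply_of_ne_of_ne (fun h => hik ?_) hik
          apply σ.injective
          rw [hσ i ⟨hik, hi⟩, ← h]
    · rintro ⟨j, τ⟩ h
      simp only [Finset.mem_filter, Finset.mem_univ, true_and, Finset.mem_insert, not_or,
        Finset.mem_sigma, Equiv.Perm.mul_apply] at h ⊢
      rintro i ⟨hik, hi⟩
      rw [h.2 i hi]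
      refine Equiv.swap_apply_of_ne_of_ne ?_ hik
      rintro rfl
      rcases h.1 with h | h
      · exact hik h
      · exact hi h
    · intro σ _
      simp [← mul_assoc]
    · rintro ⟨j, τ⟩ h
      simp only [Finset.mem_filter, Finset.mem_univ, true_and, Finset.mem_insert,
        Finset.mem_sigma] at h
      have : (Equiv.swap j k * τ) k = j := by simp [h.2 k hk]
      simp only [this]
      simp [← mul_assoc]
    · intro σ _
      simp only [mul_smul_comm, smul_smul, ← map_mul, ← mul_assoc, Equiv.swap_mul_self, one_mul]
      congr 1
      rw [← Units.val_mul, ← map_mul, ← mul_assoc, Equiv.swap_mul_self, one_mul]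
  rw [key, Finset.sum_insert hk, sub_mul, sub_eq_add_neg, Finset.sum_mul, ← Finset.sum_neg_distrib]
  congr 1
  · rw [Equiv.swap_self, ← Equiv.Perm.one_def]
    simp
  · refine Finset.sum_congr rfl fun j hj => ?_
    rw [Equiv.Perm.sign_swap (by rintro rfl; exact hk hj)]
    simp

lemma alt_mul_evLam {S : Finset (Fin N)} {p : MvPolynomial (Fin N) ℂ}
    (hp : ∀ σ : Equiv.Perm (Fin N), (∀ i, i ∉ S → σ i = i) → rename σ p = p) :
    H.alt S * H.evLam p = H.evLam p * H.alt S := by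
  rw [alt, Finset.sum_mul, Finset.mul_sum]
  refine Finset.sum_congr rfl fun σ hσ => ?_
  simp only [Finset.mem_filter, Finset.mem_univ, true_and] at hσ
  rw [smul_mul_assoc, s_evLam, hp σ hσ, mul_smul_comm]

lemma alt_mul_evK {S : Finset (Fin N)} {p : MvPolynomial (Fin N) ℂ}
    (hp : ∀ σ : Equiv.Perm (Fin N), (∀ i, i ∉ S → σ i = i) → rename σ p = p) :
    H.alt S * H.evK p = H.evK p * H.alt S := by
  rw [alt, Finset.sum_mul, Finset.mul_sum]
  refine Finset.sum_congr rfl fun σ hσ => ?_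
  simp only [Finset.mem_filter, Finset.mem_univ, true_and] at hσ
  rw [smul_mul_assoc, s_evK, hp σ hσ, mul_smul_comm]


/-- The universal central polynomial, up to sign, written as a sum over sets of fixed points. -/
def univPoly (u v : ℂ) : A :=
  ∑ T : Finset (Fin N), ((-1 : ℤ) ^ T.card) •
    (H.evLam (rootProd v T) * H.evK (rootProd u T) * H.alt (Finset.univ \ T))

lemma alt_insert_mul_evLam (v : ℂ) {k : Fin N} {R : Finset (Fin N)} (hk : k ∉ R) :
    H.alt (insert k R) * H.evLam (C v - X k) = H.evLam (C v - X k) * H.alt (insert k R) -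
      ∑ j ∈ R, (H.evLam (C v - X j) - H.evLam (C v - X k)) * (H.s (Equiv.swap j k) * H.alt R) := by
  have h4 : H.alt R * H.evLam (C v - X k) = H.evLam (C v - X k) * H.alt R :=
    H.alt_mul_evLam fun σ hσ => by simp [hσ k hk]
  have h5 : ∀ j, H.s (Equiv.swap j k) * H.evLam (C v - X k) =
      H.evLam (C v - X j) * H.s (Equiv.swap j k) := fun j => by
    rw [s_evLam]
    simp
  rw [H.alt_insert hk, mul_assoc, h4, ← mul_assoc, sub_mul, Finset.sum_mul,
    Finset.sum_congr rfl (fun j _ => h5 j)]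
  simp only [sub_mul, mul_sub, Finset.sum_mul, Finset.mul_sum, Finset.sum_sub_distrib, one_mul,
    mul_assoc]
  abel

lemma sum_powerset_sum_mem {M : Type*} [AddCommMonoid M] {α : Type*} [DecidableEq α]
    (U : Finset α) (f : Finset α → α → M) :
    ∑ S ∈ U.powerset, ∑ l ∈ S, f S l = ∑ S ∈ U.powerset, ∑ l ∈ U \ S, f (insert l S) l := by
  rw [Finset.sum_sigma', Finset.sum_sigma']
  refine Finset.sum_bij' (fun x _ => ⟨x.1.erase x.2, x.2⟩) (fun x _ => ⟨insert x.2 x.1, x.2⟩)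
    ?_ ?_ ?_ ?_ ?_
  · rintro ⟨S, l⟩ h
    simp only [Finset.mem_sigma, Finset.mem_powerset, Finset.mem_sdiff] at h ⊢
    exact ⟨(Finset.erase_subset _ _).trans h.1, h.1 h.2, by simp⟩
  · rintro ⟨S, l⟩ h
    simp only [Finset.mem_sigma, Finset.mem_powerset, Finset.mem_sdiff] at h ⊢
    exact ⟨Finset.insert_subset h.2.1 h.1, by simp⟩
  · rintro ⟨S, l⟩ h
    simp only [Finset.mem_sigma] at h
    simp [Finset.insert_erase h.2]
  · rintro ⟨S, l⟩ h
    simp only [Finset.mem_sigma, Finset.mem_sdiff] at h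
    simp [Finset.erase_insert h.2.2]
  · rintro ⟨S, l⟩ h
    simp only [Finset.mem_sigma] at h
    simp [Finset.insert_erase h.2]

/-- The commutator of `v - lam k` with the two terms of `univPoly` indexed by `S` and
`insert k S`. -/
lemma commutator_terms (u v : ℂ) (k : Fin N) (S : Finset (Fin N)) (hS : k ∉ S)
    (R : Finset (Fin N)) (hR : R = Finset.univ.erase k \ S) :
    (H.evLam (rootProd v S) * H.evK (rootProd u S) * H.alt (insert k R) -
      H.evLam (rootProd v (insert k S)) * H.evK (rootProd u (insert k S)) * H.alt R) *
        H.evLam (C v - X k) -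
      H.evLam (C v - X k) *
      (H.evLam (rootProd v S) * H.evK (rootProd u S) * H.alt (insert k R) -
      H.evLam (rootProd v (insert k S)) * H.evK (rootProd u (insert k S)) * H.alt R) =
    ∑ l ∈ S, H.evLam (rootProd v S) * H.evK (rootProd u (S.erase l)) *
      (∑ j ∈ R, (H.s (Equiv.swap l j) - H.s (Equiv.swap l k)) * H.s (Equiv.swap j k) * H.alt R -
        H.s (Equiv.swap l k) * H.alt (insert k R)) -
    ∑ j ∈ R, H.evLam (rootProd v (insert j S)) * H.evK (rootProd u S) *
      (H.s (Equiv.swap j k) * H.alt R) := by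
  have hkR : k ∉ R := by simp [hR]
  have hjS : ∀ j ∈ R, j ∉ S := fun j hj => by
    rw [hR] at hj; exact (Finset.mem_sdiff.1 hj).2
  have h1 := H.evK_rootProd_mul_evLam u v S hS
  have h2 := H.evK_rootProd_insert_mul_evLam u v S hS
  rw [← hR] at h2
  have h3 := H.alt_insert_mul_evLam v hkR
  have h4 : H.alt R * H.evLam (C v - X k) = H.evLam (C v - X k) * H.alt R :=
    H.alt_mul_evLam fun σ hσ => by simp [hσ k hkR]
  have h6 : H.evLam (rootProd v S) * H.evLam (C v - X k) =
      H.evLam (C v - X k) * H.evLam (rootProd v S) := commEval_commute _ _ _ _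
  have hA : ∀ j ∉ S, H.evLam (rootProd v (insert j S)) =
      H.evLam (rootProd v S) * H.evLam (C v - X j) := fun j hj => by
    rw [rootProd_insert v hj, mul_comm, map_mul]
  set a := H.evLam (C v - X k) with ha
  set AS := H.evLam (rootProd v S)
  set BS := H.evK (rootProd u S) with hBS
  have t1 : AS * BS * H.alt (insert k R) * a - a * (AS * BS * H.alt (insert k R)) =
      - (∑ l ∈ S, AS * H.evK (rootProd u (S.erase l)) *
          (H.s (Equiv.swap l k) * H.alt (insert k R))) -
      ∑ j ∈ R, AS * (BS * (H.evLam (C v - X j) - a)) * (H.s (Equiv.swap j k) * H.alt R) := by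
    have e1 : AS * BS * H.alt (insert k R) * a = AS * (BS * a) * H.alt (insert k R) -
        ∑ j ∈ R, AS * (BS * (H.evLam (C v - X j) - a)) * (H.s (Equiv.swap j k) * H.alt R) := by
      rw [mul_assoc, h3, mul_sub, Finset.mul_sum]
      simp only [mul_assoc]
    have e2 : AS * (BS * a) * H.alt (insert k R) - a * (AS * BS * H.alt (insert k R)) =
      - (∑ l ∈ S, AS * H.evK (rootProd u (S.erase l)) *
          (H.s (Equiv.swap l k) * H.alt (insert k R))) := by
      rw [h1, mul_sub, sub_mul, ← mul_assoc AS a BS, h6, Finset.mul_sum, Finset.sum_mul]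
      simp only [mul_assoc]
      abel
    rw [e1, ← e2]
    abel
  have t2 : H.evLam (rootProd v (insert k S)) * H.evK (rootProd u (insert k S)) * H.alt R * a -
      a * (H.evLam (rootProd v (insert k S)) * H.evK (rootProd u (insert k S)) * H.alt R) =
      ∑ j ∈ R, AS * a * BS * (H.s (Equiv.swap j k) * H.alt R) := by
    have h7 : H.evLam (rootProd v (insert k S)) * a = a * H.evLam (rootProd v (insert k S)) :=
      commEval_commute _ _ _ _
    rw [mul_assoc _ _ a, h4, ← mul_assoc _ a, mul_assoc _ _ a, h2, mul_add, ← mul_assoc _ a, h7,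
      add_mul, hA k hS, Finset.mul_sum, Finset.mul_sum, Finset.sum_mul]
    simp only [mul_assoc]
    abel
  have t3 : ∀ j ∈ R, AS * (BS * (H.evLam (C v - X j) - a)) * (H.s (Equiv.swap j k) * H.alt R) =
      H.evLam (rootProd v (insert j S)) * BS * (H.s (Equiv.swap j k) * H.alt R) -
      AS * a * BS * (H.s (Equiv.swap j k) * H.alt R) -
      ∑ l ∈ S, AS * H.evK (rootProd u (S.erase l)) *
        ((H.s (Equiv.swap l j) - H.s (Equiv.swap l k)) * H.s (Equiv.swap j k) * H.alt R) := by
    intro j hj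
    rw [mul_sub, H.evK_rootProd_mul_evLam u v S (hjS j hj), h1, hA j (hjS j hj)]
    simp only [mul_sub, sub_mul, Finset.mul_sum, Finset.sum_mul, Finset.sum_sub_distrib, mul_assoc]
    abel
  have t4 : ∑ l ∈ S, AS * H.evK (rootProd u (S.erase l)) *
      (∑ j ∈ R, (H.s (Equiv.swap l j) - H.s (Equiv.swap l k)) * H.s (Equiv.swap j k) * H.alt R -
        H.s (Equiv.swap l k) * H.alt (insert k R)) =
      ∑ j ∈ R, ∑ l ∈ S, AS * H.evK (rootProd u (S.erase l)) *
        ((H.s (Equiv.swap l j) - H.s (Equiv.swap l k)) * H.s (Equiv.swap j k) * H.alt R) -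
      ∑ l ∈ S, AS * H.evK (rootProd u (S.erase l)) *
          (H.s (Equiv.swap l k) * H.alt (insert k R)) := by
    rw [Finset.sum_comm, ← Finset.sum_sub_distrib]
    simp only [mul_sub, Finset.mul_sum]
  rw [t4, sub_mul, mul_sub, sub_sub_sub_comm, t1, t2, Finset.sum_congr rfl t3,
    Finset.sum_sub_distrib, Finset.sum_sub_distrib]
  abel

lemma swap_mul_swap_eq {α : Type*} [DecidableEq α] {j k l : α} (hjk : j ≠ k) (hjl : j ≠ l)
    (hlk : l ≠ k) :
    Equiv.swap l k * Equiv.swap j l = Equiv.swap l j * Equiv.swap j k := by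
  rw [Equiv.mul_swap_eq_swap_mul, Equiv.swap_mul_eq_mul_swap (Equiv.swap j k)]
  simp [Equiv.swap_apply_of_ne_of_ne, hjk, hjl, hlk, hjl.symm]

theorem univPoly_mul_evLam (u v : ℂ) (k : Fin N) :
    H.univPoly u v * H.evLam (C v - X k) = H.evLam (C v - X k) * H.univPoly u v := by
  set U := (Finset.univ : Finset (Fin N)).erase k with hU
  have hkU : k ∉ U := by simp [hU]
  have huniv : (Finset.univ : Finset (Finset (Fin N))) = (insert k U).powerset := by
    rw [hU, Finset.insert_erase (Finset.mem_univ k), Finset.powerset_univ]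
  have hP : H.univPoly u v = ∑ S ∈ U.powerset, ((-1 : ℤ) ^ S.card) •
      (H.evLam (rootProd v S) * H.evK (rootProd u S) * H.alt (insert k (U \ S)) -
      H.evLam (rootProd v (insert k S)) * H.evK (rootProd u (insert k S)) * H.alt (U \ S)) := by
    rw [univPoly, huniv, Finset.sum_powerset_insert hkU, ← Finset.sum_add_distrib]
    refine Finset.sum_congr rfl fun S hS => ?_
    have hkS : k ∉ S := fun h => hkU (Finset.mem_powerset.1 hS h)
    have e1 : Finset.univ \ S = insert k (U \ S) := by
      ext i
      by_cases h : i = k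
      · subst h; simp [hkS]
      · simp [hU, h]
    have e2 : Finset.univ \ insert k S = U \ S := by
      ext i
      simp [hU]
    rw [e1, e2, Finset.card_insert_of_notMem hkS, pow_succ, smul_sub]
    simp [sub_eq_add_neg]
  rw [← sub_eq_zero, hP, Finset.sum_mul, Finset.mul_sum, ← Finset.sum_sub_distrib]
  have step : ∀ S ∈ U.powerset, ((-1 : ℤ) ^ S.card) •
      (H.evLam (rootProd v S) * H.evK (rootProd u S) * H.alt (insert k (U \ S)) -
      H.evLam (rootProd v (insert k S)) * H.evK (rootProd u (insert k S)) * H.alt (U \ S)) *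
        H.evLam (C v - X k) - H.evLam (C v - X k) * ((-1 : ℤ) ^ S.card) •
      (H.evLam (rootProd v S) * H.evK (rootProd u S) * H.alt (insert k (U \ S)) -
      H.evLam (rootProd v (insert k S)) * H.evK (rootProd u (insert k S)) * H.alt (U \ S)) = 
    ∑ l ∈ S, ((-1 : ℤ) ^ S.card) • (H.evLam (rootProd v S) * H.evK (rootProd u (S.erase l)) *
      (∑ j ∈ U \ S, (H.s (Equiv.swap l j) - H.s (Equiv.swap l k)) * H.s (Equiv.swap j k) *
        H.alt (U \ S) - H.s (Equiv.swap l k) * H.alt (insert k (U \ S)))) -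
    ∑ j ∈ U \ S, ((-1 : ℤ) ^ S.card) • (H.evLam (rootProd v (insert j S)) * H.evK (rootProd u S) *
      (H.s (Equiv.swap j k) * H.alt (U \ S))) := by
    intro S hS
    have hkS : k ∉ S := fun h => hkU (Finset.mem_powerset.1 hS h)
    rw [smul_mul_assoc, mul_smul_comm, ← smul_sub, H.commutator_terms u v k S hkS _ rfl, smul_sub,
      Finset.smul_sum, Finset.smul_sum]
  rw [Finset.sum_congr rfl step, Finset.sum_sub_distrib, sum_powerset_sum_mem,
    ← Finset.sum_sub_distrib]
  refine Finset.sum_eq_zero fun S hS => ?_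
  rw [← Finset.sum_sub_distrib]
  refine Finset.sum_eq_zero fun l hl => ?_
  have hlS : l ∉ S := (Finset.mem_sdiff.1 hl).2
  have hlk : l ≠ k := by
    rintro rfl
    exact hkU (Finset.mem_sdiff.1 hl).1
  rw [Finset.erase_insert hlS, Finset.card_insert_of_notMem hlS]
  set Q := U \ insert l S with hQ
  have hUS : U \ S = insert l Q := by
    rw [hQ, Finset.sdiff_insert, Finset.insert_erase hl]
  have hlQ : l ∉ Q := by simp [hQ]
  have hkQ : k ∉ Q := by simp [hQ, hU]
  rw [hUS, pow_succ, mul_neg_one, neg_smul, ← neg_add', ← smul_add, ← mul_add]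
  suffices h : (∑ j ∈ Q, (H.s (Equiv.swap l j) - H.s (Equiv.swap l k)) * H.s (Equiv.swap j k) *
      H.alt Q - H.s (Equiv.swap l k) * H.alt (insert k Q)) +
      H.s (Equiv.swap l k) * H.alt (insert l Q) = 0 by
    rw [h]; simp
  rw [H.alt_insert hkQ, H.alt_insert hlQ]
  have : ∑ j ∈ Q, H.s (Equiv.swap l k) * H.s (Equiv.swap j l) * H.alt Q =
      ∑ j ∈ Q, H.s (Equiv.swap l j) * H.s (Equiv.swap j k) * H.alt Q := by
    refine Finset.sum_congr rfl fun j hj => ?_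
    rw [← map_mul, ← map_mul, swap_mul_swap_eq (by rintro rfl; exact hkQ hj)
      (by rintro rfl; exact hlQ hj) hlk]
  simp only [sub_mul, mul_sub, Finset.sum_mul, Finset.mul_sum, Finset.sum_sub_distrib, one_mul,
    ← mul_assoc, this]
  abel


lemma op_evLam (p : MvPolynomial (Fin N) ℂ) : H.op.evLam p = MulOpposite.op (H.evK p) := by
  induction p using MvPolynomial.induction_on with
  | C a => simp [evLam, evK, MulOpposite.algebraMap_apply]
  | add p q hp hq => simp [hp, hq]
  | mul_X p i hp =>
    rw [map_mul, hp, mul_comm p, map_mul, MulOpposite.op_mul]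
    simp [evLam, evK, op]

lemma op_evK (p : MvPolynomial (Fin N) ℂ) : H.op.evK p = MulOpposite.op (H.evLam p) := by
  induction p using MvPolynomial.induction_on with
  | C a => simp [evLam, evK, MulOpposite.algebraMap_apply]
  | add p q hp hq => simp [hp, hq]
  | mul_X p i hp =>
    rw [map_mul, hp, mul_comm p, map_mul, MulOpposite.op_mul]
    simp [evLam, evK, op]

lemma op_alt (S : Finset (Fin N)) : H.op.alt S = MulOpposite.op (H.alt S) := by
  simp only [alt, Finset.op_sum]
  refine Finset.sum_bij' (fun σ _ => σ⁻¹) (fun σ _ => σ⁻¹) ?_ ?_ ?_ ?_ ?_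
  · intro σ hσ
    simp only [Finset.mem_filter, Finset.mem_univ, true_and] at hσ ⊢
    intro i hi
    rw [Equiv.Perm.inv_eq_iff_eq, hσ i hi]
  · intro σ hσ
    simp only [Finset.mem_filter, Finset.mem_univ, true_and] at hσ ⊢
    intro i hi
    rw [Equiv.Perm.inv_eq_iff_eq, hσ i hi]
  · simp
  · simp
  · intro σ _
    simp [op, -zsmul_eq_mul]

lemma op_univPoly (u v : ℂ) : H.op.univPoly u v = MulOpposite.op (H.univPoly v u) := by
  simp only [univPoly, Finset.op_sum]
  refine Finset.sum_congr rfl fun T _ => ?_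
  have hfix : ∀ w, ∀ σ : Equiv.Perm (Fin N), (∀ i, i ∉ Finset.univ \ T → σ i = i) →
      rename σ (rootProd w T) = rootProd w T := fun w σ hσ =>
    rename_rootProd w T σ fun i hi => hσ i (by simp [hi])
  rw [op_evLam, op_evK, op_alt, ← MulOpposite.op_mul, ← MulOpposite.op_mul, ← mul_assoc,
    H.alt_mul_evLam (hfix u), mul_assoc, H.alt_mul_evK (hfix v), ← mul_assoc, MulOpposite.op_smul]

theorem univPoly_commute_lam (u v : ℂ) (k : Fin N) : Commute (H.univPoly u v) (H.lam k) := by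
  have h : Commute (H.univPoly u v) (H.evLam (C v - X k)) := H.univPoly_mul_evLam u v k
  have h2 : H.lam k = algebraMap ℂ A v - H.evLam (C v - X k) := by simp [evLam]
  rw [h2]
  exact Commute.sub_right (Algebra.commutes v _).symm h

theorem univPoly_commute_K (u v : ℂ) (k : Fin N) : Commute (H.univPoly u v) (H.K k) := by
  have h := H.op.univPoly_commute_lam v u k
  rw [op_univPoly] at h
  exact h.unop

lemma s_mul_alt (σ : Equiv.Perm (Fin N)) (S : Finset (Fin N)) :
    H.s σ * H.alt S = H.alt (S.map σ.toEmbedding) * H.s σ := by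
  rw [alt, alt, Finset.mul_sum, Finset.sum_mul]
  refine Finset.sum_bij' (fun τ _ => σ * τ * σ⁻¹) (fun τ _ => σ⁻¹ * τ * σ) ?_ ?_ ?_ ?_ ?_
  · intro τ hτ
    simp only [Finset.mem_filter, Finset.mem_univ, true_and] at hτ ⊢
    intro i hi
    rw [Equiv.Perm.mul_apply, Equiv.Perm.mul_apply, hτ]
    · rw [← Equiv.Perm.mul_apply, mul_inv_cancel, Equiv.Perm.one_apply]
    · intro h
      exact hi (Finset.mem_map.2 ⟨_, h, by
        simp⟩)
  · intro τ hτ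
    simp only [Finset.mem_filter, Finset.mem_univ, true_and] at hτ ⊢
    intro i hi
    rw [Equiv.Perm.mul_apply, Equiv.Perm.mul_apply, hτ]
    · rw [← Equiv.Perm.mul_apply, inv_mul_cancel, Equiv.Perm.one_apply]
    · simpa using hi
  · intro τ _; group
  · intro τ _; group
  · intro τ _
    have hsign : Equiv.Perm.sign (σ * τ * σ⁻¹) = Equiv.Perm.sign τ := by
      rw [map_mul, map_mul, mul_comm (Equiv.Perm.sign σ), map_inv, mul_inv_cancel_right]
    rw [mul_smul_comm, smul_mul_assoc, ← map_mul, ← map_mul, inv_mul_cancel_right, hsign]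

theorem univPoly_commute_s (u v : ℂ) (σ : Equiv.Perm (Fin N)) :
    Commute (H.univPoly u v) (H.s σ) := by
  rw [commute_iff_eq, eq_comm, univPoly, Finset.mul_sum, Finset.sum_mul]
  refine Fintype.sum_equiv σ.finsetCongr _ _ fun T => ?_
  have hr : ∀ w, rename σ (rootProd w T) = rootProd w (T.map σ.toEmbedding) := fun w => by
    simp [rootProd, map_prod]
  have hc : (Finset.univ \ T).map σ.toEmbedding = Finset.univ \ T.map σ.toEmbedding := by
    ext i
    simp
  rw [mul_smul_comm, ← mul_assoc, ← mul_assoc, s_evLam, mul_assoc _ (H.s σ), s_evK, mul_assoc,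
    mul_assoc _ (H.s σ), s_mul_alt, hr, hr, hc]
  simp [mul_assoc]

/-- The symmetrizer. -/
def sym : A := ((Nat.factorial N : ℂ)⁻¹) • ∑ σ : Equiv.Perm (Fin N), H.s σ

lemma s_mul_sym (σ : Equiv.Perm (Fin N)) : H.s σ * H.sym = H.sym := by
  rw [sym, mul_smul_comm, Finset.mul_sum]
  congr 1
  simp only [← map_mul]
  exact Fintype.sum_equiv (Equiv.mulLeft σ) _ _ fun τ => rfl

lemma sym_mul_s (σ : Equiv.Perm (Fin N)) : H.sym * H.s σ = H.sym := by
  rw [sym, smul_mul_assoc, Finset.sum_mul]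
  congr 1
  simp only [← map_mul]
  exact Fintype.sum_equiv (Equiv.mulRight σ) _ _ fun τ => rfl

lemma sym_mul_sym : H.sym * H.sym = H.sym := by
  have h : (∑ σ : Equiv.Perm (Fin N), H.s σ) * H.sym = (Nat.factorial N : ℂ) • H.sym := by
    rw [Finset.sum_mul, Finset.sum_congr rfl (fun σ _ => H.s_mul_sym σ)]
    simp [Fintype.card_perm, Nat.cast_smul_eq_nsmul]
  conv_lhs => enter [1]; rw [sym]
  rw [smul_mul_assoc, h, smul_smul, inv_mul_cancel₀, one_smul]
  exact_mod_cast Nat.factorial_ne_zero N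

lemma sym_commute {x : A} (hx : ∀ σ, H.s σ * x = x * H.s σ) : H.sym * x = x * H.sym := by
  rw [sym, smul_mul_assoc, mul_smul_comm, Finset.sum_mul, Finset.mul_sum,
    Finset.sum_congr rfl (fun σ _ => hx σ)]

lemma alt_mul_sym (S : Finset (Fin N)) : H.alt S * H.sym = if S.card ≤ 1 then H.sym else 0 := by
  induction S using Finset.induction_on with
  | empty => simp [alt_empty]
  | insert k S hk ih =>
    rw [H.alt_insert hk, mul_assoc, ih, Finset.card_insert_of_notMem hk]
    have hcalc : (1 - ∑ j ∈ S, H.s (Equiv.swap j k)) * H.sym = H.sym - S.card • H.sym := by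
      rw [sub_mul, one_mul, Finset.sum_mul, Finset.sum_congr rfl (fun j _ => H.s_mul_sym _),
        Finset.sum_const]
    rcases Nat.lt_trichotomy S.card 1 with h | h | h
    · rw [if_pos h.le, if_pos (by omega), hcalc, Nat.lt_one_iff.1 h]
      simp
    · rw [if_pos h.le, if_neg (by omega), hcalc, h]
      simp
    · rw [if_neg (by omega), if_neg (by omega), mul_zero]

lemma univPoly_mul_sym (u v : ℂ) : ((-1 : ℤ) ^ N) • (H.univPoly u v * H.sym) =
    H.evLam (rootProd v Finset.univ) * H.evK (rootProd u Finset.univ) * H.sym -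
    ∑ k, H.evLam (rootProd v (Finset.univ.erase k)) * H.evK (rootProd u (Finset.univ.erase k)) *
      H.sym := by
  set f : Finset (Fin N) → A := fun T => ((-1 : ℤ) ^ N * (-1 : ℤ) ^ T.card) •
    (H.evLam (rootProd v T) * H.evK (rootProd u T) * (H.alt (Finset.univ \ T) * H.sym)) with hf
  have hinj : Function.Injective fun k : Fin N => Finset.univ.erase k := fun i j hij => by
    by_contra hne
    have : i ∈ Finset.univ.erase j := by simp [hne]
    exact Finset.notMem_erase i Finset.univ (by simpa only [hij] using this)
  have hsub : ∑ T ∈ insert Finset.univ (Finset.univ.image fun k : Fin N => Finset.univ.erase k),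
      f T = ∑ T, f T := by
    refine Finset.sum_subset (Finset.subset_univ _) fun T _ hT => ?_
    simp only [hf, alt_mul_sym]
    rw [if_neg, mul_zero, smul_zero]
    intro hcard
    apply hT
    rw [← Finset.compl_eq_univ_sdiff] at hcard
    rcases Nat.le_one_iff_eq_zero_or_eq_one.1 hcard with h | h
    · rw [Finset.card_eq_zero, Finset.compl_eq_empty_iff] at h
      simp [h]
    · obtain ⟨k, hk⟩ := Finset.card_eq_one.1 h
      refine Finset.mem_insert_of_mem (Finset.mem_image.2 ⟨k, Finset.mem_univ k, ?_⟩)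
      rw [← compl_compl T, hk, Finset.compl_singleton]
  have hP : ((-1 : ℤ) ^ N) • (H.univPoly u v * H.sym) = ∑ T, f T := by
    rw [univPoly, Finset.sum_mul, Finset.smul_sum]
    refine Finset.sum_congr rfl fun T _ => ?_
    rw [smul_mul_assoc, smul_smul, mul_assoc _ (H.alt _)]
  have hnot : Finset.univ ∉ Finset.univ.image fun k : Fin N => Finset.univ.erase k := by
    intro h
    obtain ⟨k, _, hk⟩ := Finset.mem_image.1 h
    have := Finset.mem_univ k
    rw [← hk] at this
    exact Finset.notMem_erase k Finset.univ this
  rw [hP, ← hsub, Finset.sum_insert hnot, Finset.sum_image fun _ _ _ _ h => hinj h, sub_eq_add_neg,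
    ← Finset.sum_neg_distrib]
  congr 1
  · simp [hf, alt_empty, -zsmul_eq_mul, ← mul_pow]
  · refine Finset.sum_congr rfl fun k _ => ?_
    have hN : 0 < N := k.pos
    have hk : (Finset.univ \ Finset.univ.erase k).card ≤ 1 := by
      rw [← Finset.compl_eq_univ_sdiff, Finset.compl_erase]
      simp
    obtain ⟨n, rfl⟩ : ∃ n, N = n + 1 := ⟨N - 1, by omega⟩
    simp only [hf, alt_mul_sym, if_pos hk]
    simp [pow_succ, -zsmul_eq_mul, ← mul_pow]

end CherednikData

lemma coeff_mem_of_forall_sum_pow_smul_mem {V ι : Type*} [AddCommGroup V] [Module ℂ V] [Fintype ι]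
    (W : Submodule ℂ V) (e : ι → ℕ) (he : Function.Injective e) (m : ι → V)
    (h : ∀ t : ℂ, ∑ i, t ^ e i • m i ∈ W) (i : ι) : m i ∈ W := by
  rw [← Submodule.Quotient.mk_eq_zero, ← Module.forall_dual_apply_eq_zero_iff ℂ]
  intro f
  have hp : ∑ j, Polynomial.C (f (Submodule.Quotient.mk (m j))) * Polynomial.X ^ e j = 0 := by
    refine Polynomial.funext fun t => ?_
    have ht := congrArg f ((Submodule.Quotient.mk_eq_zero W).2 (h t))
    rw [← Submodule.mkQ_apply, map_sum, map_sum, map_zero] at ht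
    simp only [map_smul, Submodule.mkQ_apply, smul_eq_mul] at ht
    simpa only [Polynomial.eval_finsetSum, Polynomial.eval_mul, Polynomial.eval_C,
      Polynomial.eval_pow, Polynomial.eval_X, Polynomial.eval_zero, mul_comm] using ht
  have hc := congrArg (fun q : Polynomial ℂ => q.coeff (e i)) hp
  simp only [Polynomial.finsetSum_coeff, Polynomial.coeff_C_mul, Polynomial.coeff_X_pow,
    Polynomial.coeff_zero] at hc
  rw [Finset.sum_eq_single i] at hc
  · simpa using hc
  · intro j _ hj
    rw [if_neg (fun h => hj (he h).symm), mul_zero]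
  · simp

lemma coeff_mem_of_forall_sum_pow_mul_pow_smul_mem {V ι : Type*} [AddCommGroup V] [Module ℂ V]
    [Fintype ι] (W : Submodule ℂ V) (e : ι → ℕ) (he : Function.Injective e) (m : ι → ι → V)
    (h : ∀ u v : ℂ, ∑ i, ∑ j, (v ^ e i * u ^ e j) • m i j ∈ W) (i j : ι) : m i j ∈ W := by
  refine coeff_mem_of_forall_sum_pow_smul_mem W e he (m i) (fun u => ?_) j
  refine coeff_mem_of_forall_sum_pow_smul_mem W e he (fun i => ∑ j, u ^ e j • m i j) (fun v => ?_) i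
  simpa [Finset.smul_sum, smul_smul] using h u v

namespace CherednikData

/-- The polynomial `∏_{i ∈ T} (X - X_i)` in one variable over the polynomial ring. -/
def rootPoly {N : ℕ} (T : Finset (Fin N)) : Polynomial (MvPolynomial (Fin N) ℂ) :=
  ∏ i ∈ T, (Polynomial.X - Polynomial.C (X i))

lemma natDegree_rootPoly {N : ℕ} (T : Finset (Fin N)) : (rootPoly T).natDegree = T.card :=
  Polynomial.natDegree_finsetProd_X_sub_C_eq_card T _

lemma monic_rootPoly {N : ℕ} (T : Finset (Fin N)) : (rootPoly T).Monic :=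
  Polynomial.monic_prod_of_monic _ _ fun _ _ => Polynomial.monic_X_sub_C _

lemma coeff_card_rootPoly {N : ℕ} (T : Finset (Fin N)) : (rootPoly T).coeff T.card = 1 := by
  rw [← natDegree_rootPoly T]
  exact monic_rootPoly T

lemma coeff_rootPoly_of_lt {N : ℕ} {T : Finset (Fin N)} {n : ℕ} (h : T.card < n) :
    (rootPoly T).coeff n = 0 :=
  Polynomial.coeff_eq_zero_of_natDegree_lt (by rwa [natDegree_rootPoly])

lemma rootProd_eq_sum {N : ℕ} (u : ℂ) (T : Finset (Fin N)) :
    rootProd u T = ∑ n : Fin (N + 1), u ^ (n : ℕ) • (rootPoly T).coeff n := by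
  have h1 : rootProd u T = (rootPoly T).eval (C u) := by
    simp [rootProd, rootPoly, Polynomial.eval_prod]
  have h2 : (rootPoly T).natDegree < N + 1 := by
    rw [natDegree_rootPoly]
    have := Finset.card_le_univ T
    simp only [Fintype.card_fin] at this
    omega
  rw [h1, Polynomial.eval_eq_sum_range' h2, Finset.sum_range]
  exact Finset.sum_congr rfl fun n _ => by rw [smul_eq_C_mul, mul_comm, C_pow]

lemma rename_coeff_rootPoly {N : ℕ} (σ : Equiv.Perm (Fin N)) (T : Finset (Fin N)) (n : ℕ) :
    rename σ ((rootPoly T).coeff n) = (rootPoly (T.map σ.toEmbedding)).coeff n := by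
  have h : (rootPoly T).map (rename σ : MvPolynomial (Fin N) ℂ →ₐ[ℂ] _).toRingHom =
      rootPoly (T.map σ.toEmbedding) := by
    simp [rootPoly, Polynomial.map_prod]
  rw [← h, Polynomial.coeff_map]
  rfl

lemma X_mul_coeff_zero_rootPoly_erase {N : ℕ} (k : Fin N) :
    X k * (rootPoly (Finset.univ.erase k)).coeff 0 = - (rootPoly Finset.univ).coeff 0 := by
  have h : rootPoly Finset.univ = (Polynomial.X - Polynomial.C (X k)) *
      rootPoly (Finset.univ.erase k) :=
    (Finset.mul_prod_erase Finset.univ _ (Finset.mem_univ k)).symm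
  rw [h, Polynomial.mul_coeff_zero]
  simp

lemma X_mul_coeff_succ_rootPoly_erase {N : ℕ} (k : Fin N) (n : ℕ) :
    X k * (rootPoly (Finset.univ.erase k)).coeff (n + 1) =
      (rootPoly (Finset.univ.erase k)).coeff n - (rootPoly Finset.univ).coeff (n + 1) := by
  have h : rootPoly Finset.univ = (Polynomial.X - Polynomial.C (X k)) *
      rootPoly (Finset.univ.erase k) :=
    (Finset.mul_prod_erase Finset.univ _ (Finset.mem_univ k)).symm
  rw [h, sub_mul, Polynomial.coeff_sub, Polynomial.coeff_X_mul, Polynomial.coeff_C_mul]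
  ring

lemma coeff_pred_rootPoly_erase {N : ℕ} (k : Fin N) :
    (rootPoly (Finset.univ.erase k)).coeff (N - 1) = 1 := by
  convert coeff_card_rootPoly (Finset.univ.erase k) using 2
  simp

variable {N : ℕ} {A : Type*} [Ring A] [Algebra ℂ A] (H : CherednikData N A)

lemma evK_mul_sym {p : MvPolynomial (Fin N) ℂ} (hp : ∀ σ : Equiv.Perm (Fin N), rename σ p = p) :
    H.sym * H.evK p = H.evK p * H.sym :=
  H.sym_commute fun σ => by rw [s_evK, hp]

lemma rename_coeff_rootPoly_univ (σ : Equiv.Perm (Fin N)) (n : ℕ) :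
    rename σ ((rootPoly (Finset.univ : Finset (Fin N))).coeff n) =
      (rootPoly (Finset.univ : Finset (Fin N))).coeff n := by
  rw [rename_coeff_rootPoly, Finset.map_univ_equiv]

/-- Coefficients of `univPoly * sym` up to sign. -/
def symCoeff (n m : ℕ) : A :=
  H.evLam ((rootPoly Finset.univ).coeff n) * H.evK ((rootPoly Finset.univ).coeff m) * H.sym -
  ∑ k, H.evLam ((rootPoly (Finset.univ.erase k)).coeff n) *
    H.evK ((rootPoly (Finset.univ.erase k)).coeff m) * H.sym

lemma univPoly_mul_sym_eq_sum (u v : ℂ) : ((-1 : ℤ) ^ N) • (H.univPoly u v * H.sym) =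
    ∑ n : Fin (N + 1), ∑ m : Fin (N + 1), (v ^ (n : ℕ) * u ^ (m : ℕ)) • H.symCoeff n m := by
  have key : ∀ T, H.evLam (rootProd v T) * H.evK (rootProd u T) * H.sym =
      ∑ n : Fin (N + 1), ∑ m : Fin (N + 1), (v ^ (n : ℕ) * u ^ (m : ℕ)) •
        (H.evLam ((rootPoly T).coeff n) * H.evK ((rootPoly T).coeff m) * H.sym) := fun T => by
    rw [rootProd_eq_sum, rootProd_eq_sum, map_sum, map_sum, Finset.sum_mul_sum, Finset.sum_mul]
    refine Finset.sum_congr rfl fun n _ => ?_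
    rw [Finset.sum_mul]
    refine Finset.sum_congr rfl fun m _ => ?_
    rw [map_smul, map_smul, smul_mul_assoc, mul_smul_comm, smul_smul, smul_mul_assoc]
  rw [univPoly_mul_sym, key, Finset.sum_congr rfl fun k _ => key (Finset.univ.erase k)]
  simp only [symCoeff, smul_sub, Finset.sum_sub_distrib, Finset.smul_sum]
  congr 1
  rw [Finset.sum_comm]
  exact Finset.sum_congr rfl fun n _ => Finset.sum_comm

section Generation

variable {B : NonUnitalSubalgebra ℂ A} (hP : ∀ u v, H.univPoly u v * H.sym ∈ B)

include hP

lemma symCoeff_mem (n m : ℕ) : H.symCoeff n m ∈ B := by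
  have hz : ∀ T : Finset (Fin N), ∀ n, N < n → (rootPoly T).coeff n = 0 := fun T n hn =>
    coeff_rootPoly_of_lt (lt_of_le_of_lt (by simpa using Finset.card_le_univ T) hn)
  by_cases hn : n < N + 1
  · by_cases hm : m < N + 1
    · refine coeff_mem_of_forall_sum_pow_mul_pow_smul_mem B.toSubmodule
        (fun i : Fin (N + 1) => (i : ℕ)) Fin.val_injective (fun i j => H.symCoeff i j)
        (fun u v => ?_) ⟨n, hn⟩ ⟨m, hm⟩
      rw [← univPoly_mul_sym_eq_sum]
      exact zsmul_mem (S := NonUnitalSubalgebra ℂ A) (hP u v) _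
    · have : H.symCoeff n m = 0 := by simp [symCoeff, hz _ m (by omega)]
      rw [this]
      exact B.zero_mem
  · have : H.symCoeff n m = 0 := by simp [symCoeff, hz _ n (by omega)]
    rw [this]
    exact B.zero_mem

lemma evK_coeff_mul_sym_mem (n : ℕ) : H.evK ((rootPoly Finset.univ).coeff n) * H.sym ∈ B := by
  have h := H.symCoeff_mem hP N n
  have h1 : (rootPoly (Finset.univ : Finset (Fin N))).coeff N = 1 := by
    simpa using coeff_card_rootPoly (Finset.univ : Finset (Fin N))
  have h2 : ∀ k : Fin N, (rootPoly (Finset.univ.erase k)).coeff N = 0 := fun k =>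
    coeff_rootPoly_of_lt (by simpa using k.pos)
  simpa [symCoeff, h1, h2] using h

lemma evLam_coeff_mul_sym_mem (n : ℕ) : H.evLam ((rootPoly Finset.univ).coeff n) * H.sym ∈ B := by
  have h := H.symCoeff_mem hP n N
  have h1 : (rootPoly (Finset.univ : Finset (Fin N))).coeff N = 1 := by
    simpa using coeff_card_rootPoly (Finset.univ : Finset (Fin N))
  have h2 : ∀ k : Fin N, (rootPoly (Finset.univ.erase k)).coeff N = 0 := fun k =>
    coeff_rootPoly_of_lt (by simpa using k.pos)
  simpa [symCoeff, h1, h2] using h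

lemma sum_evLam_coeff_mul_evK_coeff_mem (n m : ℕ) :
    (∑ k, H.evLam ((rootPoly (Finset.univ.erase k)).coeff n) *
      H.evK ((rootPoly (Finset.univ.erase k)).coeff m)) * H.sym ∈ B := by
  have h := H.symCoeff_mem hP n m
  have h1 := mul_mem (H.evLam_coeff_mul_sym_mem hP n) (H.evK_coeff_mul_sym_mem hP m)
  have h2 : H.evLam ((rootPoly Finset.univ).coeff n) * H.sym *
      (H.evK ((rootPoly Finset.univ).coeff m) * H.sym) =
      H.evLam ((rootPoly Finset.univ).coeff n) * H.evK ((rootPoly Finset.univ).coeff m) * H.sym := by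
    rw [mul_assoc, ← mul_assoc H.sym, H.evK_mul_sym fun σ => rename_coeff_rootPoly_univ σ m,
      mul_assoc _ H.sym, sym_mul_sym, ← mul_assoc]
  rw [h2] at h1
  have h3 := sub_mem h1 h
  rw [symCoeff, sub_sub_cancel, ← Finset.sum_mul] at h3
  exact h3

lemma sum_mul_evK_X_pow_mem (b n m : ℕ) :
    (∑ k, H.evLam ((rootPoly (Finset.univ.erase k)).coeff n) *
      H.evK (X k ^ b * (rootPoly (Finset.univ.erase k)).coeff m)) * H.sym ∈ B := by
  induction b generalizing m with
  | zero => simpa using H.sum_evLam_coeff_mul_evK_coeff_mem hP n m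
  | succ b ih =>
    have hs : ∀ l, (∑ k, H.evLam ((rootPoly (Finset.univ.erase k)).coeff n) *
        H.evK (X k ^ b * (rootPoly Finset.univ).coeff l)) * H.sym ∈ B := fun l => by
      have h := mul_mem (ih (N - 1)) (H.evK_coeff_mul_sym_mem hP l)
      have h2 := H.evK_mul_sym fun σ => rename_coeff_rootPoly_univ σ l
      rw [mul_assoc, ← mul_assoc H.sym, h2, mul_assoc _ H.sym, sym_mul_sym, ← mul_assoc,
        Finset.sum_mul] at h
      simpa only [coeff_pred_rootPoly_erase, mul_one, map_mul, mul_assoc] using h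
    cases m with
    | zero =>
      have h := neg_mem (hs 0)
      simpa only [pow_succ, mul_assoc, X_mul_coeff_zero_rootPoly_erase, mul_neg, map_neg,
        Finset.sum_neg_distrib, neg_mul] using h
    | succ m =>
      have h := sub_mem (ih m) (hs (m + 1))
      simpa only [pow_succ, mul_assoc, X_mul_coeff_succ_rootPoly_erase, mul_sub, map_sub,
        Finset.sum_sub_distrib, sub_mul] using h

lemma sum_evLam_X_pow_mul_mem (a b n : ℕ) :
    (∑ k, H.evLam (X k ^ a * (rootPoly (Finset.univ.erase k)).coeff n) * H.evK (X k ^ b)) *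
      H.sym ∈ B := by
  induction a generalizing n with
  | zero => simpa [coeff_pred_rootPoly_erase] using H.sum_mul_evK_X_pow_mem hP b n (N - 1)
  | succ a ih =>
    have hs : ∀ l, (∑ k, H.evLam (X k ^ a * (rootPoly Finset.univ).coeff l) *
        H.evK (X k ^ b)) * H.sym ∈ B := fun l => by
      have h := mul_mem (H.evLam_coeff_mul_sym_mem hP l) (ih (N - 1))
      have h2 : H.sym * (∑ k, H.evLam (X k ^ a) * H.evK (X k ^ b)) =
          (∑ k, H.evLam (X k ^ a) * H.evK (X k ^ b)) * H.sym := by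
        refine H.sym_commute fun σ => ?_
        rw [Finset.mul_sum, Finset.sum_mul]
        refine Fintype.sum_equiv σ _ _ fun k => ?_
        rw [← mul_assoc, s_evLam, mul_assoc, s_evK, ← mul_assoc]
        simp
      simp only [coeff_pred_rootPoly_erase, mul_one] at h
      rw [mul_assoc, ← mul_assoc H.sym, h2, mul_assoc _ H.sym, sym_mul_sym, ← mul_assoc,
        Finset.mul_sum] at h
      simpa only [mul_comm (X _ ^ a), map_mul, mul_assoc] using h
    cases n with
    | zero =>
      have h := neg_mem (hs 0)
      simpa only [pow_succ, mul_assoc, X_mul_coeff_zero_rootPoly_erase, mul_neg, map_neg,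
        Finset.sum_neg_distrib, neg_mul] using h
    | succ n =>
      have h := sub_mem (ih n) (hs (n + 1))
      simpa only [pow_succ, mul_assoc, X_mul_coeff_succ_rootPoly_erase, mul_sub, map_sub,
        Finset.sum_sub_distrib, sub_mul] using h

lemma sum_lam_pow_mul_K_pow_mem (a b : ℕ) : (∑ k, H.lam k ^ a * H.K k ^ b) * H.sym ∈ B := by
  simpa [coeff_pred_rootPoly_erase, evLam, evK] using H.sum_evLam_X_pow_mul_mem hP a b (N - 1)

end Generation

end CherednikData

namespace CherednikData

variable {N : ℕ} {A : Type*} [Ring A] [Algebra ℂ A] (H : CherednikData N A)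

/-- The generators `lam i` and `K i`, indexed by a sum type. -/
def gen : Fin N ⊕ Fin N → A := Sum.elim H.lam H.K

/-- The product of the generators listed in `l`. -/
def word (l : List (Fin N ⊕ Fin N)) : A := (l.map H.gen).prod

@[simp]
lemma word_nil : H.word [] = 1 := rfl

@[simp]
lemma word_cons (x : Fin N ⊕ Fin N) (l : List (Fin N ⊕ Fin N)) :
    H.word (x :: l) = H.gen x * H.word l := by
  simp [word]

lemma word_append (l₁ l₂ : List (Fin N ⊕ Fin N)) :
    H.word (l₁ ++ l₂) = H.word l₁ * H.word l₂ := by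
  simp [word]

lemma s_gen (σ : Equiv.Perm (Fin N)) (x : Fin N ⊕ Fin N) :
    H.s σ * H.gen x = H.gen (Sum.map σ σ x) * H.s σ := by
  rcases x with i | i
  · exact H.s_lam σ i
  · exact H.s_K σ i

lemma s_word (σ : Equiv.Perm (Fin N)) (l : List (Fin N ⊕ Fin N)) :
    H.s σ * H.word l = H.word (l.map (Sum.map σ σ)) * H.s σ := by
  induction l with
  | nil => simp
  | cons x l ih =>
    rw [List.map_cons, word_cons, word_cons, ← mul_assoc, s_gen, mul_assoc, ih, mul_assoc]

/-- The span of group elements and of generators times group elements. -/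
def filtOne : Submodule ℂ A :=
  Submodule.span ℂ (Set.range H.s ∪
    Set.range fun x : (Fin N ⊕ Fin N) × Equiv.Perm (Fin N) => H.gen x.1 * H.s x.2)

lemma s_mem_filtOne (σ : Equiv.Perm (Fin N)) : H.s σ ∈ H.filtOne :=
  Submodule.subset_span (Or.inl ⟨σ, rfl⟩)

lemma gen_mem_filtOne (x : Fin N ⊕ Fin N) : H.gen x ∈ H.filtOne :=
  Submodule.subset_span (Or.inr ⟨(x, 1), by simp⟩)

lemma one_le_filtOne : 1 ≤ H.filtOne := by
  rw [Submodule.one_le]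
  simpa using H.s_mem_filtOne 1

lemma filtOne_pow_mono {m n : ℕ} (h : m ≤ n) : H.filtOne ^ m ≤ H.filtOne ^ n :=
  pow_le_pow_right₀ H.one_le_filtOne h

lemma word_mem (l : List (Fin N ⊕ Fin N)) : H.word l ∈ H.filtOne ^ l.length := by
  induction l with
  | nil => rw [List.length_nil, pow_zero]; exact Submodule.one_le.1 le_rfl
  | cons x l ih =>
    rw [word_cons, List.length_cons, pow_succ']
    exact Submodule.mul_mem_mul (H.gen_mem_filtOne x) ih

lemma filtOne_pow_le (d : ℕ) : H.filtOne ^ d ≤ Submodule.span ℂ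
    {a | ∃ l : List (Fin N ⊕ Fin N), ∃ σ, l.length ≤ d ∧ a = H.word l * H.s σ} := by
  induction d with
  | zero =>
    rw [pow_zero, Submodule.one_le]
    exact Submodule.subset_span ⟨[], 1, le_rfl, by simp⟩
  | succ d ih =>
    rw [pow_succ']
    refine (mul_le_mul' le_rfl ih).trans ?_
    rw [filtOne, Submodule.span_mul_span, Submodule.span_le]
    rintro _ ⟨_, (⟨σ, rfl⟩ | ⟨⟨x, σ⟩, rfl⟩), _, ⟨l, τ, hl, rfl⟩, rfl⟩
    · refine Submodule.subset_span ⟨l.map (Sum.map σ σ), σ * τ, by simp; omega, ?_⟩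
      simp only
      rw [← mul_assoc, s_word, map_mul, mul_assoc]
    · refine Submodule.subset_span ⟨x :: l.map (Sum.map σ σ), σ * τ, by simp; omega, ?_⟩
      simp only
      rw [word_cons, mul_assoc, ← mul_assoc (H.s σ), s_word, map_mul]
      simp only [mul_assoc]

lemma gen_commutator_mem (x y : Fin N ⊕ Fin N) :
    H.gen x * H.gen y - H.gen y * H.gen x ∈ H.filtOne := by
  have key : ∀ i j, H.K i * H.lam j - H.lam j * H.K i ∈ H.filtOne := fun i j => by
    by_cases hij : i = j
    · subst hij
      rw [K_lam_self, add_sub_cancel_left]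
      exact Submodule.sum_mem _ fun j _ => H.s_mem_filtOne _
    · rw [H.K_lam_of_ne i j hij, sub_sub_cancel_left]
      exact Submodule.neg_mem _ (H.s_mem_filtOne _)
  rcases x with i | i <;> rcases y with j | j <;> simp only [gen, Sum.elim_inl, Sum.elim_inr]
  · rw [(H.lam_comm i j).eq, sub_self]
    exact Submodule.zero_mem _
  · rw [← neg_sub]
    exact Submodule.neg_mem _ (key j i)
  · exact key i j
  · rw [(H.K_comm i j).eq, sub_self]
    exact Submodule.zero_mem _

lemma word_sub_word_mem {l₁ l₂ : List (Fin N ⊕ Fin N)} (h : l₁.Perm l₂) :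
    H.word l₁ - H.word l₂ ∈ H.filtOne ^ (l₁.length - 1) := by
  induction h with
  | nil => simp
  | @cons x l₁ l₂ h ih =>
    rw [word_cons, word_cons, ← mul_sub, List.length_cons, Nat.add_sub_cancel]
    rcases l₁ with _ | ⟨y, l⟩
    · rw [List.nil_perm.1 h, sub_self, mul_zero]
      exact Submodule.zero_mem _
    · rw [List.length_cons, pow_succ']
      exact Submodule.mul_mem_mul (H.gen_mem_filtOne x) ih
  | swap x y l =>
    rw [word_cons, word_cons, word_cons, word_cons, ← mul_assoc, ← mul_assoc, ← sub_mul,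
      List.length_cons, List.length_cons, Nat.add_sub_cancel, pow_succ']
    exact Submodule.mul_mem_mul (H.gen_commutator_mem y x) (H.word_mem l)
  | @trans l₁ l₂ l₃ h₁ h₂ ih₁ ih₂ =>
    rw [← h₁.length_eq] at ih₂
    simpa using Submodule.add_mem _ ih₁ ih₂

/-- The set of indices occurring in a list of generators. -/
def supp (l : List (Fin N ⊕ Fin N)) : Finset (Fin N) := (l.map (Sum.elim id id)).toFinset

lemma exists_perm_filter_append (k : Fin N) (l : List (Fin N ⊕ Fin N)) :
    ∃ a b, l.Perm (l.filter (fun x => Sum.elim id id x ≠ k) ++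
      (List.replicate a (Sum.inl k) ++ List.replicate b (Sum.inr k))) := by
  induction l with
  | nil => exact ⟨0, 0, by simp⟩
  | cons x l ih =>
    obtain ⟨a, b, h⟩ := ih
    by_cases hx : Sum.elim id id x = k
    · rw [List.filter_cons_of_neg (by simpa using hx)]
      rcases x with i | i <;> simp only [Sum.elim_inl, Sum.elim_inr, id] at hx <;> subst hx
      · refine ⟨a + 1, b, (h.cons _).trans ?_⟩
        rw [List.replicate_succ, List.cons_append]
        exact List.perm_middle.symm
      · refine ⟨a, b + 1, (h.cons _).trans ?_⟩
        rw [List.replicate_succ, ← List.append_assoc, ← List.append_assoc]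
        exact List.perm_middle.symm
    · rw [List.filter_cons_of_pos (by simpa using hx)]
      exact ⟨a, b, h.cons _⟩

theorem sym_mul_mul_sym_mem_of_filtOne {B : NonUnitalSubalgebra ℂ A} (hE : H.sym ∈ B)
    (hP : ∀ u v, H.univPoly u v * H.sym ∈ B) (d : ℕ) :
    ∀ x ∈ H.filtOne ^ d, H.sym * x * H.sym ∈ B := by
  induction d using Nat.strong_induction_on with
  | _ d ih =>
  have hlin : ∀ S : Set A, (∀ x ∈ S, H.sym * x * H.sym ∈ B) →
      ∀ x ∈ Submodule.span ℂ S, H.sym * x * H.sym ∈ B := by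
    intro S hS x hx
    induction hx using Submodule.span_induction with
    | mem x hx => exact hS x hx
    | zero => simp
    | add x y _ _ hx hy => simpa [mul_add, add_mul] using add_mem hx hy
    | smul a x _ hx => simpa using SMulMemClass.smul_mem a hx
  have hlt : ∀ l : List (Fin N ⊕ Fin N), l.length < d → H.sym * H.word l * H.sym ∈ B :=
    fun l hl => ih _ hl _ (H.word_mem l)
  have heq : ∀ r, ∀ l : List (Fin N ⊕ Fin N), l.length = d → (supp l).card = r →
      H.sym * H.word l * H.sym ∈ B := by
    intro r
    induction r using Nat.strong_induction_on with
    | _ r ihr =>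
    intro l hl hr
    rcases l.eq_nil_or_concat with rfl | ⟨l₀, x₀, hl₀⟩
    · simpa [sym_mul_sym] using hE
    have hx₀ : x₀ ∈ l := by simp [hl₀]
    clear hl₀ l₀
    set k : Fin N := Sum.elim id id x₀ with hk
    set l' := l.filter (fun x => Sum.elim id id x ≠ k) with hl'
    obtain ⟨a, b, hperm⟩ := exists_perm_filter_append k l
    set m : Fin N → List (Fin N ⊕ Fin N) := fun j =>
      l' ++ (List.replicate a (Sum.inl j) ++ List.replicate b (Sum.inr j)) with hm
    change l.Perm (m k) at hperm
    have hlen : ∀ j, (m j).length = d := fun j => by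
      rw [← hl, hperm.length_eq]
      simp [hm]
    have hkl : k ∉ supp l' := by
      simp [supp, hl']
    have hl'd : l'.length < d := by
      rw [← hl, hl', List.length_filter_lt_length_iff_exists]
      exact ⟨x₀, hx₀, by simp [hk]⟩
    have hsub : insert k (supp l') ⊆ supp l := by
      intro j hj
      rw [Finset.mem_insert] at hj
      simp only [supp, List.mem_toFinset, List.mem_map] at hj ⊢
      rcases hj with rfl | ⟨x, hx, rfl⟩
      · exact ⟨x₀, hx₀, rfl⟩
      · exact ⟨x, List.mem_of_mem_filter hx, rfl⟩
    have hcard : (supp l').card < r := by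
      have := Finset.card_le_card hsub
      rw [Finset.card_insert_of_notMem hkl, hr] at this
      omega
    have hword : ∀ j, H.word (m j) = H.word l' * (H.lam j ^ a * H.K j ^ b) := fun j => by
      rw [hm, word_append, word_append]
      simp [word, gen]
    have hin : ∀ j ∈ supp l', H.sym * H.word (m j) * H.sym ∈ B := by
      intro j hj
      refine ihr (supp (m j)).card (lt_of_le_of_lt (Finset.card_le_card ?_) hcard) _ (hlen j) rfl
      intro i hi
      simp only [supp, hm, List.mem_toFinset, List.mem_map, List.mem_append,
        List.mem_replicate] at hi hj ⊢
      rcases hi with ⟨x, hx | ⟨_, rfl⟩ | ⟨_, rfl⟩, rfl⟩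
      · exact ⟨x, hx, rfl⟩
      · exact hj
      · exact hj
    have hout : ∀ j ∉ supp l', H.sym * H.word (m j) * H.sym = H.sym * H.word (m k) * H.sym := by
      intro j hj
      have hmap : (m k).map (Sum.map (Equiv.swap k j) (Equiv.swap k j)) = m j := by
        have h1 : l'.map (Sum.map (Equiv.swap k j) (Equiv.swap k j)) = l' := by
          conv_rhs => rw [← List.map_id l']
          refine List.map_congr_left fun x hx => ?_
          have hxs : Sum.elim id id x ∈ supp l' := by
            simp only [supp, List.mem_toFinset, List.mem_map]
            exact ⟨x, hx, rfl⟩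
          have h2 : Sum.elim id id x ≠ k := fun h => hkl (h ▸ hxs)
          have h3 : Sum.elim id id x ≠ j := fun h => hj (h ▸ hxs)
          rcases x with i | i <;> simp only [Sum.elim_inl, Sum.elim_inr, id] at h2 h3 <;>
            simp [Equiv.swap_apply_of_ne_of_ne h2 h3]
        simp only [hm, List.map_append, List.map_replicate, h1, Sum.map_inl, Sum.map_inr,
          Equiv.swap_apply_left]
      have h4 := H.s_word (Equiv.swap k j) (m k)
      rw [hmap] at h4
      calc H.sym * H.word (m j) * H.sym
          = H.sym * (H.word (m j) * H.s (Equiv.swap k j)) * H.sym := by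
            rw [mul_assoc, mul_assoc, mul_assoc, s_mul_sym]
        _ = H.sym * H.word (m k) * H.sym := by rw [← h4, ← mul_assoc, sym_mul_s]
    have hprod := mul_mem (hlt l' hl'd) (H.sum_lam_pow_mul_K_pow_mem hP a b)
    have hps : H.sym * (∑ k, H.lam k ^ a * H.K k ^ b) = (∑ k, H.lam k ^ a * H.K k ^ b) * H.sym := by
      refine H.sym_commute fun σ => ?_
      rw [Finset.mul_sum, Finset.sum_mul]
      refine Fintype.sum_equiv σ _ _ fun k => ?_
      have e1 : ∀ i n, H.s σ * H.lam i ^ n = H.lam (σ i) ^ n * H.s σ := fun i n =>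
        SemiconjBy.pow_right (H.s_lam σ i) n
      have e2 : ∀ i n, H.s σ * H.K i ^ n = H.K (σ i) ^ n * H.s σ := fun i n =>
        SemiconjBy.pow_right (H.s_K σ i) n
      rw [← mul_assoc, e1, mul_assoc, e2, ← mul_assoc]
    have hsum : H.sym * H.word l' * H.sym * ((∑ k, H.lam k ^ a * H.K k ^ b) * H.sym) =
        ∑ j, H.sym * H.word (m j) * H.sym := by
      rw [mul_assoc _ H.sym, ← mul_assoc H.sym (∑ k, _), hps, mul_assoc _ H.sym H.sym, sym_mul_sym,
        Finset.sum_mul, Finset.mul_sum]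
      refine Finset.sum_congr rfl fun j _ => ?_
      rw [hword]
      simp only [mul_assoc]
    rw [hsum, ← Finset.sum_add_sum_compl (supp l'),
      Finset.sum_congr rfl (fun j hj => hout j (Finset.mem_compl.1 hj)), Finset.sum_const] at hprod
    have hdiff := sub_mem hprod (sum_mem hin)
    rw [add_sub_cancel_left, ← Nat.cast_smul_eq_nsmul ℂ] at hdiff
    have hne : ((supp l')ᶜ.card : ℂ) ≠ 0 := by
      rw [Nat.cast_ne_zero, Finset.card_ne_zero]
      exact ⟨k, Finset.mem_compl.2 hkl⟩
    have hmk : H.sym * H.word (m k) * H.sym ∈ B := by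
      have := SMulMemClass.smul_mem ((supp l')ᶜ.card : ℂ)⁻¹ hdiff
      rwa [smul_smul, inv_mul_cancel₀ hne, one_smul] at this
    have hrest := ih (l.length - 1) (by have := List.length_pos_of_mem hx₀; omega) _
      (H.word_sub_word_mem hperm)
    have := add_mem hrest hmk
    rwa [← add_mul, ← mul_add, sub_add_cancel] at this
  intro x hx
  refine hlin _ ?_ x (H.filtOne_pow_le d hx)
  rintro _ ⟨l, σ, hl, rfl⟩
  rw [mul_assoc, mul_assoc, s_mul_sym, ← mul_assoc]
  rcases hl.lt_or_eq with h | h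
  · exact hlt l h
  · exact heq _ l h rfl

lemma exists_mem_filtOne_pow {x : A}
    (hx : x ∈ Algebra.adjoin ℂ (Set.range H.lam ∪ Set.range H.K ∪ Set.range H.s)) :
    ∃ d, x ∈ H.filtOne ^ d := by
  induction hx using Algebra.adjoin_induction with
  | mem x hx =>
    refine ⟨1, ?_⟩
    rw [pow_one]
    rcases hx with (⟨i, rfl⟩ | ⟨i, rfl⟩) | ⟨σ, rfl⟩
    · exact H.gen_mem_filtOne (Sum.inl i)
    · exact H.gen_mem_filtOne (Sum.inr i)
    · exact H.s_mem_filtOne σ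
  | algebraMap a =>
    exact ⟨0, by rw [pow_zero]; exact Submodule.algebraMap_mem a⟩
  | add x y _ _ hx hy =>
    obtain ⟨m, hm⟩ := hx
    obtain ⟨n, hn⟩ := hy
    exact ⟨max m n, Submodule.add_mem _ (H.filtOne_pow_mono (le_max_left m n) hm)
      (H.filtOne_pow_mono (le_max_right m n) hn)⟩
  | mul x y _ _ hx hy =>
    obtain ⟨m, hm⟩ := hx
    obtain ⟨n, hn⟩ := hy
    exact ⟨m + n, by rw [pow_add]; exact Submodule.mul_mem_mul hm hn⟩

theorem sym_mul_mul_sym_mem {B : NonUnitalSubalgebra ℂ A} (hE : H.sym ∈ B)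
    (hP : ∀ u v, H.univPoly u v * H.sym ∈ B) {x : A}
    (hx : x ∈ Algebra.adjoin ℂ (Set.range H.lam ∪ Set.range H.K ∪ Set.range H.s)) :
    H.sym * x * H.sym ∈ B := by
  obtain ⟨d, hd⟩ := H.exists_mem_filtOne_pow hx
  exact H.sym_mul_mul_sym_mem_of_filtOne hE hP d x hd

/-- An element commuting with the `lam i` and killed by right multiplication by the symmetrizer
vanishes after multiplication by a product of differences of the `lam i`. -/
lemma prod_differences_mul_eq_zero {x : A} (hx : ∀ i, Commute x (H.lam i)) (h : x * H.sym = 0) :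
    H.evLam (∏ e ∈ (Finset.univ : Finset (Fin N × Fin N)).filter (fun e => e.1 ≠ e.2),
      (X e.1 - X e.2)) * x = 0 := by
  have hC : ∀ p, Commute x (H.evLam p) := fun p => by
    induction p using MvPolynomial.induction_on with
    | C a => rw [evLam, commEval_C]; exact (Algebra.commutes a x).symm
    | add p q hp hq => rw [map_add]; exact hp.add_right hq
    | mul_X p i hp => rw [map_mul]; exact hp.mul_right (by simpa [evLam] using hx i)
  have key : ∀ T : Finset (Fin N × Fin N), ∑ σ : Equiv.Perm (Fin N),
      H.evLam (∏ e ∈ T, (X (σ e.1) - X e.2)) * x * H.s σ = 0 := by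
    intro T
    induction T using Finset.induction_on with
    | empty =>
      have h1 : (Nat.factorial N : ℂ) ≠ 0 := by exact_mod_cast Nat.factorial_ne_zero N
      have h2 := congrArg (fun y => (Nat.factorial N : ℂ) • y) h
      simp only [sym, mul_smul_comm, smul_smul, mul_inv_cancel₀ h1, one_smul, smul_zero,
        Finset.mul_sum] at h2
      simpa using h2
    | insert e T he ih =>
      have hterm : ∀ σ : Equiv.Perm (Fin N),
          H.evLam (∏ e ∈ insert e T, (X (σ e.1) - X e.2)) * x * H.s σ =
          H.evLam (∏ e ∈ T, (X (σ e.1) - X e.2)) * x * H.s σ * H.lam e.1 -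
          H.lam e.2 * (H.evLam (∏ e ∈ T, (X (σ e.1) - X e.2)) * x * H.s σ) := fun σ => by
        have hl : ∀ i, H.lam i = H.evLam (X i) := fun i => by simp [evLam]
        have e1 : H.evLam (∏ e ∈ T, (X (σ e.1) - X e.2)) * x * H.s σ * H.lam e.1 =
            H.evLam (X (σ e.1) * ∏ e ∈ T, (X (σ e.1) - X e.2)) * x * H.s σ := by
          rw [mul_assoc _ (H.s σ), s_lam, hl, ← mul_assoc _ _ (H.s σ), mul_assoc _ x,
            (hC _).eq, ← mul_assoc, ← map_mul, mul_comm (X (σ e.1))]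
        rw [e1, Finset.prod_insert he, sub_mul, map_sub, sub_mul, sub_mul, map_mul H.evLam (X e.2),
          hl]
        simp only [mul_assoc]
      rw [Finset.sum_congr rfl fun σ _ => hterm σ, Finset.sum_sub_distrib, ← Finset.sum_mul,
        ← Finset.mul_sum, ih, zero_mul, mul_zero, sub_zero]
  have hT := key (Finset.univ.filter fun e => e.1 ≠ e.2)
  rw [Finset.sum_eq_single 1] at hT
  · simpa using hT
  · intro σ _ hσ
    obtain ⟨i, hi⟩ : ∃ i, σ i ≠ i := by
      by_contra hcon
      push Not at hcon
      exact hσ (Equiv.ext hcon)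
    rw [Finset.prod_eq_zero (i := (i, σ i)) (by simpa using hi.symm) (by simp)]
    simp
  · simp

end CherednikData

/-- The commutator of two of the `K i` commutes with the `lam k`. -/
lemma commutator_K_commute_lam {N : ℕ} {A : Type*} [Ring A] {lam K : Fin N → A}
    {s : Equiv.Perm (Fin N) →* A} (s_K : ∀ σ i, s σ * K i = K (σ i) * s σ)
    (K_lam_of_ne : ∀ i j, i ≠ j → K i * lam j = lam j * K i - s (Equiv.swap i j))
    (K_lam_self : ∀ i, K i * lam i = lam i * K i +
      ∑ j ∈ Finset.univ.erase i, s (Equiv.swap i j)) {i j : Fin N} (hij : i ≠ j) (k : Fin N) :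
    Commute (K i * K j - K j * K i) (lam k) := by
  have key : ∀ {i j : Fin N}, i ≠ j → (K i * K j - K j * K i) * lam j =
      lam j * (K i * K j - K j * K i) := by
    intro i j hij
    have h1 : K i * (∑ l ∈ Finset.univ.erase j, s (Equiv.swap j l)) -
        (∑ l ∈ Finset.univ.erase j, s (Equiv.swap j l)) * K i =
        K i * s (Equiv.swap i j) - s (Equiv.swap i j) * K i := by
      rw [Finset.mul_sum, Finset.sum_mul, ← Finset.sum_sub_distrib,
        Finset.sum_eq_single_of_mem i (by simp [hij]), Equiv.swap_comm]
      intro l hl hli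
      rw [s_K, Equiv.swap_apply_of_ne_of_ne hij hli.symm, sub_self]
    have h2 := s_K (Equiv.swap i j) i
    have h3 := s_K (Equiv.swap i j) j
    rw [Equiv.swap_apply_left] at h2
    rw [Equiv.swap_apply_right] at h3
    have e1 : K i * K j * lam j = lam j * (K i * K j) - s (Equiv.swap i j) * K j +
        K i * ∑ l ∈ Finset.univ.erase j, s (Equiv.swap j l) := by
      rw [mul_assoc, K_lam_self, mul_add, ← mul_assoc, K_lam_of_ne i j hij, sub_mul, mul_assoc]
    have e2 : K j * K i * lam j = lam j * (K j * K i) +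
        (∑ l ∈ Finset.univ.erase j, s (Equiv.swap j l)) * K i - K j * s (Equiv.swap i j) := by
      rw [mul_assoc, K_lam_of_ne i j hij, mul_sub, ← mul_assoc, K_lam_self, add_mul, mul_assoc]
    rw [sub_mul, e1, e2, mul_sub]
    rw [sub_eq_iff_eq_add] at h1
    rw [h1, h2, h3]
    abel
  rw [commute_iff_eq]
  by_cases hkj : k = j
  · rw [hkj]
    exact key hij
  by_cases hki : k = i
  · have h := key hij.symm
    rw [hki, ← neg_sub, neg_mul, h, mul_neg]
  have hc : ∀ {i j : Fin N}, i ≠ j → k ≠ j → k ≠ i →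
      K i * K j * lam k = lam k * (K i * K j) - s (Equiv.swap i k) * K j -
        s (Equiv.swap j k) * K i := by
    intro i j hij hkj hki
    rw [mul_assoc, K_lam_of_ne j k (Ne.symm hkj), mul_sub, ← mul_assoc,
      K_lam_of_ne i k (Ne.symm hki), sub_mul, mul_assoc, s_K (Equiv.swap j k) i,
      Equiv.swap_apply_of_ne_of_ne hij (Ne.symm hki)]
  rw [sub_mul, hc hij hkj hki, hc hij.symm hki hkj, mul_sub]
  abel

section Realization

variable {N : ℕ}

@[simp]
lemma mulP_apply (p q : Rzl N) : mulP N p q = p * q := rfl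

@[simp]
lemma permOp_apply (σ : Equiv.Perm (Fin N)) (p : Rzl N) : permOp N σ p = permHat N σ p := rfl

lemma permHat_apply (σ : Equiv.Perm (Fin N)) (p : Rzl N) :
    permHat N σ p = rename (Sum.map σ σ) p := rfl

lemma sZ_apply (i j : Fin N) (p : Rzl N) :
    sZ N i j p = rename (Sum.map (Equiv.swap i j) id) p := rfl

lemma sL_apply (i j : Fin N) (p : Rzl N) :
    sL N i j p = rename (Sum.map id (Equiv.swap i j)) p := rfl

/-- The action of the symmetric group on `ℂ[z,λ]`. -/
def permHom (N : ℕ) : Equiv.Perm (Fin N) →* Module.End ℂ (Rzl N) where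
  toFun := permOp N
  map_one' := by
    refine LinearMap.ext fun p => ?_
    simp [permHat_apply]
  map_mul' σ τ := by
    refine LinearMap.ext fun p => ?_
    simp only [permOp_apply, Module.End.mul_apply, permHat_apply, rename_rename, Sum.map_comp_map]
    rfl

@[simp]
lemma permHom_apply (σ : Equiv.Perm (Fin N)) : permHom N σ = permOp N σ := rfl

lemma sZ_sL (i j : Fin N) (p : Rzl N) :
    sZ N i j (sL N i j p) = permHat N (Equiv.swap i j) p := by
  simp [sZ_apply, sL_apply, permHat_apply, rename_rename, Sum.map_comp_map]

lemma permOp_mul_mulP (σ : Equiv.Perm (Fin N)) (i : Fin N) :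
    permOp N σ * mulP N (X (Sum.inr i)) = mulP N (X (Sum.inr (σ i))) * permOp N σ := by
  refine LinearMap.ext fun p => ?_
  simp [permHat_apply]

/-- `ℂ[z,λ]` is generated over `ℂ[λ]` by `ℂ[z]`. -/
lemma eq_zero_of_semilinear {T : Module.End ℂ (Rzl N)} (f : Fin N → Fin N)
    (hT : ∀ k, T * mulP N (X (Sum.inr k)) = mulP N (X (Sum.inr (f k))) * T)
    (h0 : ∀ q : MvPolynomial (Fin N) ℂ, T (rename Sum.inl q) = 0) : T = 0 := by
  have key : ∀ p : Rzl N, ∀ q : MvPolynomial (Fin N) ℂ, T (p * rename Sum.inl q) = 0 := by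
    intro p
    induction p using MvPolynomial.induction_on with
    | C a =>
      intro q
      rw [← rename_C Sum.inl a, ← map_mul]
      exact h0 _
    | add p q hp hq =>
      intro r
      rw [add_mul, map_add, hp, hq, add_zero]
    | mul_X p i hp =>
      intro q
      rcases i with i | i
      · rw [mul_assoc, ← rename_X Sum.inl i, ← map_mul]
        exact hp _
      · have h := LinearMap.congr_fun (hT i) (p * rename Sum.inl q)
        simp only [Module.End.mul_apply, mulP_apply, hp, mul_zero] at h
        rw [mul_right_comm, mul_comm, h]
  refine LinearMap.ext fun p => ?_
  have h := key p 1
  rwa [map_one, mul_one] at h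

variable {D : Fin N → Fin N → Rzl N → Rzl N}

lemma X_inr_sub_X_inr_ne_zero {i j : Fin N} (h : i ≠ j) :
    (X (Sum.inr i) - X (Sum.inr j) : Rzl N) ≠ 0 := by
  rw [sub_ne_zero]
  exact fun e => h (Sum.inr_injective (X_injective e))

section DividedDifference

variable (hD : ∀ i j : Fin N, i ≠ j → ∀ p : Rzl N,
  (X (Sum.inr i) - X (Sum.inr j)) * D i j p = p - sL N i j p)
include hD

lemma dividedDifference_mul_of_ne {i j k : Fin N} (hij : i ≠ j) (hki : k ≠ i) (hkj : k ≠ j)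
    (p : Rzl N) : D i j (X (Sum.inr k) * p) = X (Sum.inr k) * D i j p := by
  refine mul_left_cancel₀ (X_inr_sub_X_inr_ne_zero hij) ?_
  rw [hD i j hij, mul_left_comm, hD i j hij]
  simp [sL_apply, Equiv.swap_apply_of_ne_of_ne hki hkj, mul_sub]

lemma dividedDifference_mul_left {i j : Fin N} (hij : i ≠ j) (p : Rzl N) :
    D i j (X (Sum.inr i) * p) = X (Sum.inr i) * D i j p + sL N i j p := by
  refine mul_left_cancel₀ (X_inr_sub_X_inr_ne_zero hij) ?_
  rw [hD i j hij, mul_add, mul_left_comm, hD i j hij]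
  simp only [sL_apply, map_mul, rename_X, Sum.map_inr, Equiv.swap_apply_left]
  ring

lemma dividedDifference_mul_right {i j : Fin N} (hij : i ≠ j) (p : Rzl N) :
    D i j (X (Sum.inr j) * p) = X (Sum.inr j) * D i j p - sL N i j p := by
  refine mul_left_cancel₀ (X_inr_sub_X_inr_ne_zero hij) ?_
  rw [hD i j hij, mul_sub, mul_left_comm, hD i j hij]
  simp only [sL_apply, map_mul, rename_X, Sum.map_inr, Equiv.swap_apply_right]
  ring

lemma dividedDifference_rename_inl {i j : Fin N} (hij : i ≠ j) (q : MvPolynomial (Fin N) ℂ) :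
    D i j (rename Sum.inl q) = 0 := by
  refine mul_left_cancel₀ (X_inr_sub_X_inr_ne_zero hij) ?_
  rw [hD i j hij, sL_apply, rename_rename, mul_zero, sub_eq_zero]
  rfl

variable {K : Fin N → Module.End ℂ (Rzl N)}
  (hK : ∀ (i : Fin N) (p : Rzl N),
    K i p = X (Sum.inl i) * p + ∑ j ∈ Finset.univ.erase i, sZ N i j (D i j p))
include hK

lemma K_rename_inl (i : Fin N) (q : MvPolynomial (Fin N) ℂ) :
    K i (rename Sum.inl q) = rename Sum.inl (X i * q) := by
  rw [hK, Finset.sum_eq_zero, add_zero, map_mul, rename_X]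
  intro j hj
  rw [dividedDifference_rename_inl hD (Finset.ne_of_mem_erase hj).symm, map_zero]

lemma K_mul_mulP_of_ne (i k : Fin N) (hik : i ≠ k) :
    K i * mulP N (X (Sum.inr k)) =
      mulP N (X (Sum.inr k)) * K i - permHom N (Equiv.swap i k) := by
  refine LinearMap.ext fun p => ?_
  simp only [Module.End.mul_apply, mulP_apply, LinearMap.sub_apply, permHom_apply, permOp_apply,
    hK]
  have hk : k ∈ Finset.univ.erase i := by simp [hik.symm]
  rw [← Finset.add_sum_erase _ _ hk, ← Finset.add_sum_erase _ _ hk,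
    dividedDifference_mul_right hD hik, map_sub, sZ_sL]
  have hsum : ∑ j ∈ (Finset.univ.erase i).erase k, sZ N i j (D i j (X (Sum.inr k) * p)) =
      X (Sum.inr k) * ∑ j ∈ (Finset.univ.erase i).erase k, sZ N i j (D i j p) := by
    rw [Finset.mul_sum]
    refine Finset.sum_congr rfl fun j hj => ?_
    rw [Finset.mem_erase, Finset.mem_erase] at hj
    rw [dividedDifference_mul_of_ne hD hj.2.1.symm hik.symm hj.1.symm]
    simp [sZ_apply]
  rw [hsum, map_mul, sZ_apply i k (X _), rename_X, Sum.map_inr, id]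
  ring

lemma K_mul_mulP_self (i : Fin N) :
    K i * mulP N (X (Sum.inr i)) = mulP N (X (Sum.inr i)) * K i +
      ∑ j ∈ Finset.univ.erase i, permHom N (Equiv.swap i j) := by
  refine LinearMap.ext fun p => ?_
  simp only [Module.End.mul_apply, mulP_apply, LinearMap.add_apply, LinearMap.sum_apply,
    permHom_apply, permOp_apply, hK]
  rw [mul_add, mul_left_comm, add_assoc, Finset.mul_sum, ← Finset.sum_add_distrib]
  congr 1
  refine Finset.sum_congr rfl fun j hj => ?_
  rw [dividedDifference_mul_left hD (Finset.ne_of_mem_erase hj).symm, map_add, sZ_sL, map_mul]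
  simp [sZ_apply]

lemma permHom_mul_K (σ : Equiv.Perm (Fin N)) (i : Fin N) :
    permHom N σ * K i = K (σ i) * permHom N σ := by
  rw [← sub_eq_zero]
  refine eq_zero_of_semilinear σ (fun k => ?_) fun q => ?_
  · have hs : ∀ k, permHom N σ * mulP N (X (Sum.inr k)) =
        mulP N (X (Sum.inr (σ k))) * permHom N σ := permOp_mul_mulP σ
    have hsw : ∀ j, permHom N σ * permHom N (Equiv.swap i j) =
        permHom N (Equiv.swap (σ i) (σ j)) * permHom N σ := fun j => by
      rw [← map_mul, ← map_mul, Equiv.mul_swap_eq_swap_mul]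
    rw [sub_mul, mul_sub, mul_assoc, mul_assoc, hs]
    by_cases hik : i = k
    · subst hik
      have hsum : permHom N σ * ∑ j ∈ Finset.univ.erase i, permHom N (Equiv.swap i j) =
          (∑ j ∈ Finset.univ.erase (σ i), permHom N (Equiv.swap (σ i) j)) * permHom N σ := by
        rw [Finset.mul_sum, Finset.sum_mul]
        exact Finset.sum_equiv σ (by simp) fun j _ => hsw j
      rw [K_mul_mulP_self hD hK, mul_add, ← mul_assoc (K _), K_mul_mulP_self hD hK, add_mul,
        ← mul_assoc (permHom N σ), hs, hsum]
      simp only [mul_assoc]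
      abel
    · rw [K_mul_mulP_of_ne hD hK _ _ hik, mul_sub, ← mul_assoc (K _),
        K_mul_mulP_of_ne hD hK _ _ (σ.injective.ne hik), sub_mul, ← mul_assoc (permHom N σ), hs,
        hsw]
      simp only [mul_assoc]
      abel
  · have h : ∀ q : MvPolynomial (Fin N) ℂ,
        permHat N σ (rename Sum.inl q) = rename Sum.inl (rename σ q) := fun q => by
      rw [permHat_apply, rename_rename, rename_rename]
      rfl
    simp only [LinearMap.sub_apply, Module.End.mul_apply, permHom_apply, permOp_apply, h,
      K_rename_inl hD hK]
    rw [map_mul (rename σ), rename_X, sub_self]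

lemma K_commute (i j : Fin N) : Commute (K i) (K j) := by
  by_cases hij : i = j
  · rw [hij]
  rw [commute_iff_eq, ← sub_eq_zero]
  refine eq_zero_of_semilinear id (fun k => ?_) fun q => ?_
  · exact commutator_K_commute_lam (lam := fun k => mulP N (X (Sum.inr k)))
      (permHom_mul_K hD hK) (K_mul_mulP_of_ne hD hK) (K_mul_mulP_self hD hK) hij k
  · rw [LinearMap.sub_apply, Module.End.mul_apply, Module.End.mul_apply]
    simp only [K_rename_inl hD hK]
    rw [mul_left_comm, sub_self]

end DividedDifference

/-- The realization of the rational Cherednik algebra on `ℂ[z,λ]`. -/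
def cherednikRealization
    (hD : ∀ i j : Fin N, i ≠ j → ∀ p : Rzl N,
      (X (Sum.inr i) - X (Sum.inr j)) * D i j p = p - sL N i j p)
    {K : Fin N → Module.End ℂ (Rzl N)}
    (hK : ∀ (i : Fin N) (p : Rzl N),
      K i p = X (Sum.inl i) * p + ∑ j ∈ Finset.univ.erase i, sZ N i j (D i j p)) :
    CherednikData N (Module.End ℂ (Rzl N)) where
  lam i := mulP N (X (Sum.inr i))
  K := K
  s := permHom N
  lam_comm i j := by
    rw [commute_iff_eq]
    refine LinearMap.ext fun p => ?_
    simp [mul_left_comm]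
  K_comm := K_commute hD hK
  s_lam := permOp_mul_mulP
  s_K := permHom_mul_K hD hK
  K_lam_of_ne := K_mul_mulP_of_ne hD hK
  K_lam_self := K_mul_mulP_self hD hK

end Realization

section Satake

variable {N : ℕ} {D : Fin N → Fin N → Rzl N → Rzl N}
  (hD : ∀ i j : Fin N, i ≠ j → ∀ p : Rzl N,
    (X (Sum.inr i) - X (Sum.inr j)) * D i j p = p - sL N i j p)
  {K : Fin N → Module.End ℂ (Rzl N)}
  (hK : ∀ (i : Fin N) (p : Rzl N),
    K i p = X (Sum.inl i) * p + ∑ j ∈ Finset.univ.erase i, sZ N i j (D i j p))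

lemma evLam_cherednikRealization (p : MvPolynomial (Fin N) ℂ) :
    (cherednikRealization hD hK).evLam p = mulP N (rename Sum.inr p) := by
  rw [CherednikData.evLam]
  induction p using MvPolynomial.induction_on with
  | C a =>
    rw [commEval_C, rename_C]
    refine LinearMap.ext fun p => ?_
    rw [Module.algebraMap_end_apply, mulP_apply, C_mul']
  | add p q hp hq =>
    rw [map_add, map_add, hp, hq]
    exact LinearMap.ext fun r => (add_mul _ _ r).symm
  | mul_X p i hp =>
    rw [map_mul, map_mul, hp, commEval_X, rename_X]
    exact LinearMap.ext fun r => (mul_assoc _ _ r).symm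

lemma ordProd_eq_evK (u : ℂ) (T : Finset (Fin N)) :
    ordProd T (fun i => u • (1 : Module.End ℂ (Rzl N)) - K i) =
      (cherednikRealization hD hK).evK (CherednikData.rootProd u T) := by
  rw [ordProd, CherednikData.rootProd, Finset.prod_eq_multiset_prod, ← Finset.sort_eq T (· ≤ ·),
    Multiset.map_coe, Multiset.prod_coe, map_list_prod, List.map_map]
  refine congrArg List.prod (List.map_congr_left fun i _ => ?_)
  rw [Function.comp_apply, CherednikData.evK, map_sub, commEval_C, commEval_X,
    Algebra.algebraMap_eq_smul_one]
  rfl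

lemma Puv_eq_univPoly (u v : ℂ) :
    Puv K u v = ((-1 : ℤ) ^ N) • (cherednikRealization hD hK).univPoly u v := by
  rw [Puv, CherednikData.univPoly]
  congr 1
  simp only [Finset.sum_mul, Finset.smul_sum, CherednikData.alt, Finset.mul_sum]
  rw [Finset.sum_comm' (t' := Finset.univ)
    (s' := fun T => Finset.univ.filter fun σ => ∀ i, i ∉ Finset.univ \ T → σ i = i)]
  · refine Finset.sum_congr rfl fun T _ => Finset.sum_congr rfl fun σ _ => ?_
    rw [evLam_cherednikRealization, ← ordProd_eq_evK, CherednikData.rootProd, map_prod]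
    simp only [map_sub, rename_C, rename_X, smul_mul_assoc, mul_smul_comm]
    rw [smul_comm]
    rfl
  · intro σ T
    simp [Finset.subset_iff]

lemma cherednik_eq_adjoin : cherednik N K = Algebra.adjoin ℂ
    (Set.range (cherednikRealization hD hK).lam ∪ Set.range (cherednikRealization hD hK).K ∪
      Set.range (cherednikRealization hD hK).s) := rfl

lemma mem_cherednikCenter_of_commute {x : Module.End ℂ (Rzl N)} (hx : x ∈ cherednik N K)
    (hl : ∀ i, Commute x ((cherednikRealization hD hK).lam i))
    (hk : ∀ i, Commute x ((cherednikRealization hD hK).K i))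
    (hs : ∀ σ, Commute x ((cherednikRealization hD hK).s σ)) : x ∈ cherednikCenter N K := by
  refine Algebra.mem_inf.2 ⟨hx, Subalgebra.mem_centralizer_iff ℂ |>.2 fun y hy => ?_⟩
  suffices h : Commute y x from h
  rw [SetLike.mem_coe, cherednik_eq_adjoin hD hK] at hy
  induction hy using Algebra.adjoin_induction with
  | mem y hy =>
    rcases hy with (⟨i, rfl⟩ | ⟨i, rfl⟩) | ⟨σ, rfl⟩
    · exact (hl i).symm
    · exact (hk i).symm
    · exact (hs σ).symm
  | algebraMap a => exact Algebra.commutes a x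
  | add y z _ _ hy hz => exact hy.add_left hz
  | mul y z _ _ hy hz => exact hy.mul_left hz

lemma lam_mem_cherednik (i : Fin N) : (cherednikRealization hD hK).lam i ∈ cherednik N K :=
  Algebra.subset_adjoin (Or.inl (Or.inl ⟨i, rfl⟩))

lemma K_mem_cherednik (i : Fin N) : K i ∈ cherednik N K :=
  Algebra.subset_adjoin (Or.inl (Or.inr ⟨i, rfl⟩))

lemma permOp_mem_cherednik (σ : Equiv.Perm (Fin N)) : permOp N σ ∈ cherednik N K :=
  Algebra.subset_adjoin (Or.inr ⟨σ, rfl⟩)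

lemma symE_mem_cherednik : symE N ∈ cherednik N K :=
  Subalgebra.smul_mem _ (Subalgebra.sum_mem _ fun σ _ => permOp_mem_cherednik σ) _

lemma commute_of_mem_cherednikCenter {x y : Module.End ℂ (Rzl N)} (hx : x ∈ cherednikCenter N K)
    (hy : y ∈ cherednik N K) : Commute x y :=
  (Subalgebra.mem_centralizer_iff ℂ |>.1 (Algebra.mem_inf.1 hx).2 y hy).symm

include hD hK

lemma univPoly_mem_cherednikCenter (u v : ℂ) :
    (cherednikRealization hD hK).univPoly u v ∈ cherednikCenter N K := by
  refine mem_cherednikCenter_of_commute hD hK ?_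
    ((cherednikRealization hD hK).univPoly_commute_lam u v)
    ((cherednikRealization hD hK).univPoly_commute_K u v)
    ((cherednikRealization hD hK).univPoly_commute_s u v)
  refine Subalgebra.sum_mem _ fun T _ => zsmul_mem (Subalgebra.mul_mem _ (Subalgebra.mul_mem _
    (commEval_mem_adjoin _ _ _ _ (lam_mem_cherednik hD hK))
    (commEval_mem_adjoin _ _ _ _ K_mem_cherednik)) ?_) _
  exact Subalgebra.sum_mem _ fun σ _ => zsmul_mem (permOp_mem_cherednik σ) _

lemma coeff_mem_cherednikCenter {c : Fin (N + 1) → Fin (N + 1) → Module.End ℂ (Rzl N)}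
    (hc : ∀ u v : ℂ, Puv K u v = ∑ i : Fin (N + 1), ∑ j : Fin (N + 1),
      (v ^ (N - (i : ℕ)) * u ^ (N - (j : ℕ))) • c i j) (i j : Fin (N + 1)) :
    c i j ∈ cherednikCenter N K := by
  refine coeff_mem_of_forall_sum_pow_mul_pow_smul_mem (Subalgebra.toSubmodule (cherednikCenter N K))
    (fun i : Fin (N + 1) => N - (i : ℕ)) (fun i j h => ?_) c (fun u v => ?_) i j
  · have := i.2
    have := j.2
    simp only at h
    omega
  · rw [← hc, Puv_eq_univPoly hD hK]
    exact zsmul_mem (univPoly_mem_cherednikCenter hD hK u v) _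

lemma eq_zero_of_mem_cherednikCenter_of_mul_symE {x : Module.End ℂ (Rzl N)}
    (hx : x ∈ cherednikCenter N K) (h : x * symE N = 0) : x = 0 := by
  have h0 := (cherednikRealization hD hK).prod_differences_mul_eq_zero (x := x)
    (fun i => commute_of_mem_cherednikCenter hx (lam_mem_cherednik hD hK i)) h
  rw [evLam_cherednikRealization] at h0
  refine LinearMap.ext fun p => ?_
  have h1 := LinearMap.congr_fun h0 p
  rw [Module.End.mul_apply, mulP_apply, LinearMap.zero_apply, mul_eq_zero] at h1
  refine h1.resolve_left ?_
  rw [map_prod, ← ne_eq, Finset.prod_ne_zero_iff]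
  intro e he
  rw [map_sub, rename_X, rename_X]
  exact X_inr_sub_X_inr_ne_zero (Finset.mem_filter.1 he).2

lemma spherical_eq_adjoin {c : Fin (N + 1) → Fin (N + 1) → Module.End ℂ (Rzl N)}
    (hc : ∀ u v : ℂ, Puv K u v = ∑ i : Fin (N + 1), ∑ j : Fin (N + 1),
      (v ^ (N - (i : ℕ)) * u ^ (N - (j : ℕ))) • c i j) :
    {x : Module.End ℂ (Rzl N) | ∃ a ∈ cherednik N K, x = symE N * a * symE N} =
      (NonUnitalAlgebra.adjoin ℂ
        ({symE N} ∪ {x : Module.End ℂ (Rzl N) | ∃ i j : Fin (N + 1), x = c i j * symE N}) :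
        NonUnitalSubalgebra ℂ (Module.End ℂ (Rzl N))) := by
  set S := {symE N} ∪ {x : Module.End ℂ (Rzl N) | ∃ i j : Fin (N + 1), x = c i j * symE N} with hS
  have hEE : symE N * symE N = symE N := (cherednikRealization hD hK).sym_mul_sym
  have hEH : symE N ∈ cherednik N K := symE_mem_cherednik
  ext x
  constructor
  · rintro ⟨a, ha, rfl⟩
    refine (cherednikRealization hD hK).sym_mul_mul_sym_mem
      (NonUnitalAlgebra.subset_adjoin ℂ (Or.inl rfl)) (fun u v => ?_) ha
    have h1 : (cherednikRealization hD hK).univPoly u v = ((-1 : ℤ) ^ N) • Puv K u v := by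
      rw [Puv_eq_univPoly hD hK, smul_smul, ← mul_pow]
      simp
    rw [h1, hc, smul_mul_assoc, Finset.sum_mul]
    refine zsmul_mem (S := NonUnitalSubalgebra ℂ (Module.End ℂ (Rzl N)))
      (sum_mem fun i _ => ?_) _
    rw [Finset.sum_mul]
    refine sum_mem fun j _ => ?_
    rw [smul_mul_assoc]
    exact SMulMemClass.smul_mem _ (NonUnitalAlgebra.subset_adjoin ℂ (Or.inr ⟨i, j, rfl⟩))
  · intro hx
    rw [SetLike.mem_coe] at hx
    induction hx using NonUnitalAlgebra.adjoin_induction with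
    | mem x hx =>
      rcases hx with rfl | ⟨i, j, rfl⟩
      · exact ⟨1, Subalgebra.one_mem _, by rw [mul_one, hEE]⟩
      · have hz := coeff_mem_cherednikCenter hD hK hc i j
        refine ⟨c i j, (Algebra.mem_inf.1 hz).1, ?_⟩
        rw [← (commute_of_mem_cherednikCenter hz hEH).eq, mul_assoc, hEE]
    | add x y _ _ hx hy =>
      obtain ⟨a, ha, rfl⟩ := hx
      obtain ⟨b, hb, rfl⟩ := hy
      exact ⟨a + b, Subalgebra.add_mem _ ha hb, by rw [mul_add, add_mul]⟩
    | zero => exact ⟨0, Subalgebra.zero_mem _, by rw [mul_zero, zero_mul]⟩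
    | mul x y _ _ hx hy =>
      obtain ⟨a, ha, rfl⟩ := hx
      obtain ⟨b, hb, rfl⟩ := hy
      exact ⟨a * symE N * symE N * b, Subalgebra.mul_mem _
        (Subalgebra.mul_mem _ (Subalgebra.mul_mem _ ha hEH) hEH) hb, by simp only [mul_assoc]⟩
    | smul r x _ hx =>
      obtain ⟨a, ha, rfl⟩ := hx
      exact ⟨r • a, Subalgebra.smul_mem _ ha r, by rw [mul_smul_comm, smul_mul_assoc]⟩

lemma exists_mem_cherednikCenter_mul_symE_eq
    {c : Fin (N + 1) → Fin (N + 1) → Module.End ℂ (Rzl N)}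
    (hc : ∀ u v : ℂ, Puv K u v = ∑ i : Fin (N + 1), ∑ j : Fin (N + 1),
      (v ^ (N - (i : ℕ)) * u ^ (N - (j : ℕ))) • c i j)
    {a : Module.End ℂ (Rzl N)} (ha : a ∈ cherednik N K) :
    ∃ x ∈ cherednikCenter N K, x * symE N = symE N * a * symE N := by
  have hEE : symE N * symE N = symE N := (cherednikRealization hD hK).sym_mul_sym
  have hx : symE N * a * symE N ∈ (NonUnitalAlgebra.adjoin ℂ
      ({symE N} ∪ {x : Module.End ℂ (Rzl N) | ∃ i j : Fin (N + 1), x = c i j * symE N}) :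
      NonUnitalSubalgebra ℂ (Module.End ℂ (Rzl N))) := by
    rw [← SetLike.mem_coe, ← spherical_eq_adjoin hD hK hc]
    exact ⟨a, ha, rfl⟩
  generalize symE N * a * symE N = b at hx
  induction hx using NonUnitalAlgebra.adjoin_induction with
  | mem x hx =>
    rcases hx with rfl | ⟨i, j, rfl⟩
    · exact ⟨1, Subalgebra.one_mem _, one_mul _⟩
    · exact ⟨c i j, coeff_mem_cherednikCenter hD hK hc i j, rfl⟩
  | add x y _ _ hx hy =>
    obtain ⟨a, ha, rfl⟩ := hx
    obtain ⟨b, hb, rfl⟩ := hy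
    exact ⟨a + b, Subalgebra.add_mem _ ha hb, add_mul _ _ _⟩
  | zero => exact ⟨0, Subalgebra.zero_mem _, zero_mul _⟩
  | mul x y _ _ hx hy =>
    obtain ⟨a, ha, rfl⟩ := hx
    obtain ⟨b, hb, rfl⟩ := hy
    refine ⟨a * b, Subalgebra.mul_mem _ ha hb, ?_⟩
    rw [mul_assoc a (symE N), ← mul_assoc (symE N) b,
      ← (commute_of_mem_cherednikCenter hb symE_mem_cherednik).eq, mul_assoc b, hEE, mul_assoc]
  | smul r x _ hx =>
    obtain ⟨a, ha, rfl⟩ := hx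
    exact ⟨r • a, Subalgebra.smul_mem _ ha r, smul_mul_assoc _ _ _⟩

end Satake

set_option synthInstance.maxHeartbeats 1000000 in
/-- The Satake map `c ↦ c ∘ E` is a ring isomorphism from the center of `H` onto the
spherical subalgebra `EHE`, and `EHE` is generated (as a `ℂ`-algebra with unit `E`)
by the elements `c_ij ∘ E`. -/
theorem stmt17 (N : ℕ) (hN : 0 < N)
    (D : Fin N → Fin N → Rzl N → Rzl N)
    (hD : ∀ i j : Fin N, i ≠ j → ∀ p : Rzl N,
      (X (Sum.inr i) - X (Sum.inr j)) * D i j p = p - sL N i j p)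
    (K : Fin N → Module.End ℂ (Rzl N))
    (hK : ∀ (i : Fin N) (p : Rzl N),
      K i p = X (Sum.inl i) * p + ∑ j ∈ Finset.univ.erase i, sZ N i j (D i j p))
    (c : Fin (N + 1) → Fin (N + 1) → Module.End ℂ (Rzl N))
    (hc : ∀ u v : ℂ, Puv K u v =
      ∑ i : Fin (N + 1), ∑ j : Fin (N + 1),
        (v ^ (N - (i : ℕ)) * u ^ (N - (j : ℕ))) • c i j) :
    symE N * symE N = symE N ∧
    (∀ x y : Module.End ℂ (Rzl N), x ∈ cherednikCenter N K → y ∈ cherednikCenter N K →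
      x * symE N = y * symE N → x = y) ∧
    (∀ x y : Module.End ℂ (Rzl N), x ∈ cherednikCenter N K → y ∈ cherednikCenter N K →
      (x * y) * symE N = (x * symE N) * (y * symE N)) ∧
    (∀ x ∈ cherednikCenter N K, ∃ a ∈ cherednik N K,
      x * symE N = symE N * a * symE N) ∧
    (∀ a ∈ cherednik N K, ∃ x ∈ cherednikCenter N K,
      x * symE N = symE N * a * symE N) ∧
    {x : Module.End ℂ (Rzl N) | ∃ a ∈ cherednik N K, x = symE N * a * symE N} =
      (NonUnitalAlgebra.adjoin ℂ
        ({symE N} ∪ {x : Module.End ℂ (Rzl N) | ∃ i j : Fin (N + 1), x = c i j * symE N}) :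
        NonUnitalSubalgebra ℂ (Module.End ℂ (Rzl N))) := by
  have hEE : symE N * symE N = symE N := (cherednikRealization hD hK).sym_mul_sym
  have hcomm : ∀ x ∈ cherednikCenter N K, x * symE N = symE N * x := fun x hx =>
    (commute_of_mem_cherednikCenter hx symE_mem_cherednik).eq
  refine ⟨hEE, fun x y hx hy h => ?_, fun x y _ hy => ?_, fun x hx => ?_,
    fun a ha => exists_mem_cherednikCenter_mul_symE_eq hD hK hc ha,
    spherical_eq_adjoin hD hK hc⟩
  · refine sub_eq_zero.1 (eq_zero_of_mem_cherednikCenter_of_mul_symE hD hK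
      (Subalgebra.sub_mem _ hx hy) ?_)
    rw [sub_mul, h, sub_self]
  · rw [mul_assoc x (symE N), ← mul_assoc (symE N) y, ← hcomm y hy, mul_assoc y, hEE, mul_assoc]
  · exact ⟨x, (Algebra.mem_inf.1 hx).1, by rw [← hcomm x hx, mul_assoc, hEE]⟩
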